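/- arXiv:1712.09269 — 4 statements merged into one kernel-verified Lean document; each statement's English description precedes it below -/
import Mathlib

section
/- Let H ⊆ 𝔤 be a linear subspace such that 𝔟 ⊆ H and [𝔟, H] ⊆ H (i.e., H is a 𝔟-submodule of 𝔤 containing 𝔟). Then there exists a subset S ⊆ Φ⁺ such that H = 𝔟 ⊕ ⊕_{α∈S} 𝔤_{−α}, and S satisfies the following lower-set property: if β ∈ S and α ∈ Φ⁺ satisfies α ⪯ β, then α ∈ S. -/
/-- The root space (simultaneous eigenspace) of a functional `α` on a Cartan subalgebra
`K` of a Lie algebra `L`: the subspace `{x ∈ L | [h, x] = α(h) x for all h ∈ K}`. -/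
def eigSpace {L : Type} [LieRing L] [LieAlgebra ℂ L] (K : LieSubalgebra ℂ L)
    (α : Module.Dual ℂ K) : Submodule ℂ L where
  carrier := {x : L | ∀ h : K, ⁅(h : L), x⁆ = α h • x}
  add_mem' := by
    intro a b ha hb h
    simp [lie_add, ha h, hb h, smul_add]
  zero_mem' := by intro h; simp
  smul_mem' := by
    intro c x hx h
    rw [lie_smul, hx h]
    exact smul_comm c (α h) x

/-- A finite-dimensional semisimple complex Lie algebra together with the data of a
Cartan subalgebra, its (finite) set of roots with one-dimensional root spaces and root
space decomposition, and a fixed base of simple roots: every root is a nonnegative or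
nonpositive integer combination of the simple roots. -/
structure SemisimpleWithBase (L : Type) [LieRing L] [LieAlgebra ℂ L]
    [Module.Finite ℂ L] [LieAlgebra.IsSemisimple ℂ L] where
  /-- the Cartan subalgebra `𝔥` -/
  cartan : LieSubalgebra ℂ L
  isCartan : cartan.IsCartanSubalgebra
  /-- the set `Φ ⊆ 𝔥*` of roots -/
  roots : Finset (Module.Dual ℂ cartan)
  zero_not_mem : 0 ∉ roots
  neg_mem : ∀ α ∈ roots, -α ∈ roots
  finrank_eq_one : ∀ α ∈ roots, Module.finrank ℂ (eigSpace cartan α) = 1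
  /-- the root space decomposition `𝔤 = 𝔥 ⊕ ⊕_{α ∈ Φ} 𝔤_α` -/
  decomp : cartan.toSubmodule ⊔ (⨆ α ∈ roots, eigSpace cartan α) = ⊤
  /-- the number of simple roots -/
  n : ℕ
  /-- the simple roots `α 1, …, α n` (the base `Δ`) -/
  simple : Fin n → Module.Dual ℂ cartan
  simple_mem : ∀ i, simple i ∈ roots
  simple_indep : LinearIndependent ℂ simple
  root_decomp : ∀ α ∈ roots,
      (∃ c : Fin n → ℕ, α = ∑ i, (c i : ℂ) • simple i) ∨
      (∃ c : Fin n → ℕ, α = -∑ i, (c i : ℂ) • simple i)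

namespace SemisimpleWithBase

variable {L : Type} [LieRing L] [LieAlgebra ℂ L] [Module.Finite ℂ L]
  [LieAlgebra.IsSemisimple ℂ L]
variable (D : SemisimpleWithBase L)

/-- The set `Φ⁺` of positive roots: roots which are nonnegative integer combinations of
the simple roots. -/
def posRoots : Set (Module.Dual ℂ D.cartan) :=
  {α | α ∈ D.roots ∧ ∃ c : Fin D.n → ℕ, α = ∑ i, (c i : ℂ) • D.simple i}

/-- `𝔫 = ⊕_{α ∈ Φ⁺} 𝔤_α`. -/
def nilpos : Submodule ℂ L := ⨆ α ∈ D.posRoots, eigSpace D.cartan α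

/-- The Borel subalgebra `𝔟 = 𝔥 ⊕ 𝔫` (as a subspace of `𝔤`). -/
def borel : Submodule ℂ L := D.cartan.toSubmodule ⊔ D.nilpos

/-- `α ⪯ β` : `β - α` is a nonnegative integer combination of simple roots. -/
def precEq (α β : Module.Dual ℂ D.cartan) : Prop :=
  ∃ c : Fin D.n → ℕ, β - α = ∑ i, (c i : ℂ) • D.simple i

end SemisimpleWithBase

lemma hess_exists_pos {ι M N : Type*} [Fintype ι] [AddCommGroup M] [AddCommGroup N] [Module ℂ M]
    [Module ℂ N] (P : RootPairing ι ℂ M N) [P.IsCrystallographic] [P.IsRootSystem] {n : ℕ}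
    (s : Fin n → ι) (c : Fin n → ℕ) (h : ∑ j, (c j : ℂ) • P.root (s j) ≠ 0) :
    ∃ j, 0 < c j ∧ 0 < ∑ k, (c k : ℤ) * P.pairingIn ℤ (s k) (s j) := by
  set δ := ∑ j, (c j : ℂ) • P.root (s j) with hδ
  set k : ι → ℤ := fun γ => ∑ j, (c j : ℤ) * P.pairingIn ℤ (s j) γ with hk
  have hp : ∀ a b, ((P.pairingIn ℤ a b : ℤ) : ℂ) = P.pairing a b := fun a b => by
    simpa using P.algebraMap_pairingIn ℤ a b
  have hkδ : ∀ γ, (k γ : ℂ) = P.coroot' γ δ := by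
    intro γ
    simp [hk, hδ, hp]
  have hpos : 0 < ∑ γ, k γ * k γ := by
    refine lt_of_le_of_ne (Finset.sum_nonneg fun γ _ => mul_self_nonneg _) fun h0 => h ?_
    have hz : ∀ γ, k γ = 0 := by
      intro γ
      have := (Finset.sum_eq_zero_iff_of_nonneg (fun γ _ => mul_self_nonneg (k γ))).1 h0.symm γ
        (Finset.mem_univ _)
      simpa using this
    have : P.RootForm δ = 0 := by
      ext y
      rw [P.rootForm_apply_apply]
      simp [← hkδ, hz]
    have hn := P.rootForm_nondegenerate
    exact hn.1 δ (fun y => by rw [this]; rfl)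
  have hexp : ∑ γ, k γ * k γ = ∑ j, (c j : ℤ) * ∑ γ, k γ * P.pairingIn ℤ (s j) γ := by
    simp_rw [Finset.mul_sum]
    rw [Finset.sum_comm]
    refine Finset.sum_congr rfl fun γ _ => ?_
    conv_lhs => rw [hk]
    simp only [hk, Finset.mul_sum]
    refine Finset.sum_congr rfl fun j _ => ?_
    simp only [Finset.sum_mul, Finset.mul_sum]
    refine Finset.sum_congr rfl fun i _ => ?_
    ring
  rw [hexp] at hpos
  obtain ⟨j, -, hj⟩ := Finset.exists_lt_of_sum_lt (f := fun _ => (0:ℤ)) (by simpa using hpos)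
  have hcj : 0 < c j := by
    rcases Nat.eq_zero_or_pos (c j) with h0 | h0
    · simp [h0] at hj
    · exact h0
  have hj' : 0 < ∑ γ, k γ * P.pairingIn ℤ (s j) γ := by
    exact (pos_iff_pos_of_mul_pos hj).1 (by exact_mod_cast hcj)
  refine ⟨j, hcj, ?_⟩
  change 0 < k (s j)
  have key := congrArg (fun v => P.toLinearMap δ v) (P.rootForm_self_smul_coroot (s j))
  simp only [map_smul, P.toLinearMap_apply_apply_Polarization, map_nsmul] at key
  rw [P.rootForm_apply_apply, P.rootForm_apply_apply] at key
  have h2 : P.toLinearMap δ (P.coroot (s j)) = k (s j) := by rw [hkδ]; rfl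
  rw [h2] at key
  have key' : (∑ γ, P.pairingIn ℤ (s j) γ * P.pairingIn ℤ (s j) γ) * k (s j)
      = 2 * ∑ γ, k γ * P.pairingIn ℤ (s j) γ := by
    have : (((∑ γ, P.pairingIn ℤ (s j) γ * P.pairingIn ℤ (s j) γ) * k (s j) : ℤ) : ℂ)
      = ((2 * ∑ γ, k γ * P.pairingIn ℤ (s j) γ : ℤ) : ℂ) := by
      push_cast
      simp only [hp, hkδ]
      simpa [mul_comm, hkδ] using key
    exact_mod_cast this
  have : 0 < (∑ γ, P.pairingIn ℤ (s j) γ * P.pairingIn ℤ (s j) γ) * k (s j) := by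
    rw [key']; linarith
  exact pos_of_mul_pos_right this (Finset.sum_nonneg fun γ _ => mul_self_nonneg _)

open LieAlgebra LieAlgebra.IsKilling LieModule in
lemma hess_lie_ne_zero {L : Type} [LieRing L] [LieAlgebra ℂ L] [Module.Finite ℂ L]
    [IsKilling ℂ L] {H : LieSubalgebra ℂ L} [H.IsCartanSubalgebra]
    (α β : Weight ℂ H L) (hα : α.IsNonZero) (hs : rootSpace H (α + β : H → ℂ) ≠ ⊥) :
    ∃ e ∈ rootSpace H α, ∃ x ∈ rootSpace H β, ⁅e, x⁆ ≠ 0 := by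
  have h1 := (rootSpace_zsmul_add_ne_bot_iff α β hα 1).1 (by simpa using hs)
  obtain ⟨r, hr⟩ : ∃ r, chainTopCoeff α β = r + 1 := ⟨chainTopCoeff α β - 1, by omega⟩
  have hle : chainTopCoeff α β ≤ chainLength α β := chainTopCoeff_le_chainLength α β
  obtain ⟨x, hx, x_ne0⟩ := (chainTop α β).exists_ne_zero
  obtain ⟨h, e, f, isSl2, he, hf⟩ := exists_isSl2Triple_of_weight_isNonZero hα
  obtain rfl := isSl2.h_eq_coroot hα he hf
  have prim : isSl2.HasPrimitiveVectorWith x (chainLength α β : ℂ) :=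
    have := lie_mem_genWeightSpace_of_mem_genWeightSpace he hx
    ⟨x_ne0, (chainLength_smul _ _ hx).symm, by rwa [genWeightSpace_add_chainTop _ _ hα] at this⟩
  refine ⟨e, he, ((toEnd ℂ L L f) ^ (r + 1)) x, ?_, ?_⟩
  · have := toEnd_pow_apply_mem hf hx (r + 1)
    have e1 : ((r + 1) • (-α : H → ℂ) + (chainTop α β : H → ℂ)) = β := by
      rw [coe_chainTop', hr]
      simp
    rw [e1] at this
    exact this
  · rw [prim.lie_e_pow_succ_toEnd_f]
    refine smul_ne_zero (mul_ne_zero ?_ ?_) (prim.pow_toEnd_f_ne_zero_of_eq_nat rfl (by omega))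
    · exact_mod_cast Nat.succ_ne_zero r
    · rw [sub_ne_zero]
      exact_mod_cast (by omega : chainLength α β ≠ r)

namespace SemisimpleWithBase

variable {L : Type} [LieRing L] [LieAlgebra ℂ L] [Module.Finite ℂ L]
  [LieAlgebra.IsSemisimple ℂ L] (D : SemisimpleWithBase L)

open LieAlgebra LieAlgebra.IsKilling LieModule

instance hessCartan : D.cartan.IsCartanSubalgebra := D.isCartan

lemma hess_eig (α : Module.Dual ℂ D.cartan) :
    eigSpace D.cartan α = (rootSpace D.cartan (α : D.cartan → ℂ)).toSubmodule := by
  ext x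
  constructor
  · intro hx
    refine weightSpace_le_genWeightSpace L (α : D.cartan → ℂ) ?_
    rw [mem_weightSpace]
    exact hx
  · intro hx h
    exact lie_eq_smul_of_mem_rootSpace hx h

lemma hess_zero : eigSpace D.cartan 0 = D.cartan.toSubmodule := by
  rw [hess_eig]
  have := rootSpace_zero_eq ℂ L D.cartan
  change (rootSpace D.cartan (0 : D.cartan → ℂ)).toSubmodule = _
  rw [this]
  rfl

lemma hess_indep : iSupIndep fun χ : Module.Dual ℂ D.cartan => eigSpace D.cartan χ := by
  have h := iSupIndep_genWeightSpace ℂ D.cartan L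
  have h2 := h.comp (f := fun χ : Module.Dual ℂ D.cartan => (χ : D.cartan → ℂ))
    DFunLike.coe_injective
  have h3 := (LieSubmodule.iSupIndep_toSubmodule).2 h2
  convert h3 using 2 with χ
  exact D.hess_eig χ

lemma hess_ne_bot {α : Module.Dual ℂ D.cartan} (h : α ∈ D.roots) :
    eigSpace D.cartan α ≠ ⊥ := by
  intro h0
  have := D.finrank_eq_one α h
  rw [h0] at this
  simp at this

lemma hess_mem_roots {α : Module.Dual ℂ D.cartan} (h0 : α ≠ 0)
    (h : eigSpace D.cartan α ≠ ⊥) : α ∈ D.roots := by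
  by_contra hα
  have hd := D.hess_indep α
  have : (⨆ j, ⨆ (_ : j ≠ α), eigSpace D.cartan j) = ⊤ := by
    rw [eq_top_iff, ← D.decomp, ← D.hess_zero]
    refine sup_le (le_iSup₂_of_le 0 h0.symm le_rfl) (iSup₂_le fun β hβ => ?_)
    exact le_iSup₂_of_le β (fun e => hα (e ▸ hβ)) le_rfl
  rw [this] at hd
  exact h (disjoint_top.1 hd)

/-- the Mathlib weight of a root -/
noncomputable def hessWeight (α : Module.Dual ℂ D.cartan) (h : α ∈ D.roots) : Weight ℂ D.cartan L :=
  ⟨α, fun h0 => D.hess_ne_bot h (by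
    rw [hess_eig]; exact congrArg LieSubmodule.toSubmodule h0)⟩

lemma hessWeight_nonzero (α : Module.Dual ℂ D.cartan) (h : α ∈ D.roots) :
    (D.hessWeight α h).IsNonZero := by
  intro h0
  apply D.zero_not_mem
  have : α = 0 := by
    ext x
    exact congrFun h0 x
  exact this ▸ h

/-- the Mathlib root of a root -/
noncomputable def hessRoot (α : Module.Dual ℂ D.cartan) (h : α ∈ D.roots) : D.cartan.root :=
  ⟨D.hessWeight α h, by simpa using D.hessWeight_nonzero α h⟩

lemma hess_root_hessRoot (α : Module.Dual ℂ D.cartan) (h : α ∈ D.roots) :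
    (rootSystem D.cartan).root (D.hessRoot α h) = α := by
  ext x
  rfl

lemma hess_mem_of_range {α : Module.Dual ℂ D.cartan}
    (h : α ∈ Set.range (rootSystem D.cartan).root) : α ∈ D.roots := by
  obtain ⟨w, rfl⟩ := h
  refine D.hess_mem_roots ((rootSystem D.cartan).ne_zero w) ?_
  rw [hess_eig]
  intro h0
  apply w.1.genWeightSpace_ne_bot
  rw [← LieSubmodule.toSubmodule_eq_bot]
  exact h0

lemma hess_le_or_disjoint {α : Module.Dual ℂ D.cartan} (h : α ∈ D.roots) (H : Submodule ℂ L) :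
    eigSpace D.cartan α ≤ H ∨ H ⊓ eigSpace D.cartan α = ⊥ := by
  by_cases hle : eigSpace D.cartan α ≤ H
  · exact Or.inl hle
  · have ha := Submodule.isAtom_iff_finrank_eq_one.mpr (D.finrank_eq_one α h)
    exact Or.inr ((ha.not_le_iff_disjoint.mp hle).symm.eq_bot)

lemma hess_cartan_le_borel : D.cartan.toSubmodule ≤ D.borel := le_sup_left

lemma hess_eig_le_borel {α : Module.Dual ℂ D.cartan} (h : α ∈ D.posRoots) :
    eigSpace D.cartan α ≤ D.borel :=
  le_trans (le_iSup₂_of_le (f := fun α _ => eigSpace D.cartan α) α h le_rfl) le_sup_right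

/-- `H` as a module over the Cartan subalgebra -/
def hessSub (H : Submodule ℂ L) (hmod : ∀ x ∈ D.borel, ∀ y ∈ H, ⁅x, y⁆ ∈ H) :
    LieSubmodule ℂ D.cartan L :=
  { H with lie_mem := fun {x m} hm => hmod x (D.hess_cartan_le_borel x.2) m hm }

lemma hess_le (H : Submodule ℂ L) (hmod : ∀ x ∈ D.borel, ∀ y ∈ H, ⁅x, y⁆ ∈ H) :
    H ≤ ⨆ χ : Module.Dual ℂ D.cartan, H ⊓ eigSpace D.cartan χ := by
  have h := eq_iSup_inf_genWeightSpace (K := ℂ) (L := D.cartan) (M := L)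
    (N := D.hessSub H hmod)
  have h2 := congrArg LieSubmodule.toSubmodule h
  rw [LieSubmodule.iSup_toSubmodule] at h2
  change H = _ at h2
  conv_lhs => rw [h2]
  refine iSup_le fun χ => ?_
  refine le_iSup_of_le (χ.toLinear) ?_
  rw [hess_eig]
  exact le_rfl

lemma hess_step (H : Submodule ℂ L) (hmod : ∀ x ∈ D.borel, ∀ y ∈ H, ⁅x, y⁆ ∈ H)
    {α β γ : Module.Dual ℂ D.cartan} (hα : α ∈ D.posRoots) (hβ : β ∈ D.posRoots)
    (hγ : γ ∈ D.posRoots) (e : β = α + γ) (hH : eigSpace D.cartan (-β) ≤ H) :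
    eigSpace D.cartan (-α) ≤ H := by
  have hα' := D.neg_mem _ hα.1
  have hβ' := D.neg_mem _ hβ.1
  have hsum : ((D.hessWeight γ hγ.1 : D.cartan → ℂ) + D.hessWeight (-β) hβ' : D.cartan → ℂ) =
      ((-α : Module.Dual ℂ D.cartan) : D.cartan → ℂ) := by
    subst e
    ext x
    change γ x + (-(α + γ)) x = (-α) x
    simp
  obtain ⟨u, hu, x, hx, hne⟩ := hess_lie_ne_zero (D.hessWeight γ hγ.1) (D.hessWeight (-β) hβ')
    (D.hessWeight_nonzero _ _) (by
      rw [hsum]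
      intro h0
      exact D.hess_ne_bot hα' (by rw [hess_eig, h0]; rfl))
  have hmem := lie_mem_genWeightSpace_of_mem_genWeightSpace hu hx
  rw [hsum] at hmem
  have hmem' : ⁅u, x⁆ ∈ eigSpace D.cartan (-α) := by rw [hess_eig]; exact hmem
  have hu' : u ∈ eigSpace D.cartan γ := by rw [hess_eig]; exact hu
  have hx' : x ∈ eigSpace D.cartan (-β) := by rw [hess_eig]; exact hx
  have hin : ⁅u, x⁆ ∈ H := hmod u (D.hess_eig_le_borel hγ hu') x (hH hx')
  rcases D.hess_le_or_disjoint hα' H with h | h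
  · exact h
  · exfalso
    have : ⁅u, x⁆ ∈ H ⊓ eigSpace D.cartan (-α) := ⟨hin, hmem'⟩
    rw [h] at this
    exact hne (by simpa using this)

lemma hess_simple_pos (i : Fin D.n) : D.simple i ∈ D.posRoots := by
  refine ⟨D.simple_mem i, Pi.single i 1, ?_⟩
  simp [Pi.single_apply]

lemma hess_coeff {a b : Fin D.n → ℕ}
    (h : ∑ i, (a i : ℂ) • D.simple i = ∑ i, (b i : ℂ) • D.simple i) : a = b := by
  have := Fintype.linearIndependent_iff.1 D.simple_indep (fun i => (a i : ℂ) - b i)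
    (by simp [sub_smul, h])
  ext i
  have := this i
  rw [sub_eq_zero] at this
  exact_mod_cast this

lemma hess_lower (H : Submodule ℂ L) (hmod : ∀ x ∈ D.borel, ∀ y ∈ H, ⁅x, y⁆ ∈ H) (N : ℕ) :
    ∀ (c : Fin D.n → ℕ), ∑ i, c i = N → ∀ α ∈ D.posRoots, ∀ β ∈ D.posRoots,
      β = α + ∑ i, (c i : ℂ) • D.simple i → eigSpace D.cartan (-β) ≤ H →
      eigSpace D.cartan (-α) ≤ H := by
  induction N with
  | zero =>
    intro c hc α _ β _ e hH
    have : ∀ i, c i = 0 := by simpa using hc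
    have : β = α := by simpa [this] using e
    rwa [← this]
  | succ N ih =>
    intro c hc α hα β hβ e hH
    obtain ⟨d, hd⟩ := hα.2
    have hs : ∀ j, (rootSystem D.cartan).root (D.hessRoot _ (D.simple_mem j)) = D.simple j :=
      fun j => D.hess_root_hessRoot _ _
    have hne : ∑ j, (c j : ℂ) • D.simple j ≠ 0 := by
      intro h0
      have : c = 0 := D.hess_coeff (by simpa using h0)
      simp [this] at hc
    obtain ⟨i, hci, hpos⟩ := hess_exists_pos (rootSystem D.cartan)
      (fun j => D.hessRoot _ (D.simple_mem j)) c (by simpa only [hs] using hne)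
    set P := rootSystem D.cartan with hP
    set s : Fin D.n → D.cartan.root := fun j => D.hessRoot _ (D.simple_mem j) with hsdef
    set ra := D.hessRoot α hα.1
    set rb := D.hessRoot β hβ.1
    have hra : P.root ra = α := D.hess_root_hessRoot _ _
    have hrb : P.root rb = β := D.hess_root_hessRoot _ _
    have hp : ∀ a b, ((P.pairingIn ℤ a b : ℤ) : ℂ) = P.pairing a b := fun a b => by
      simpa using P.algebraMap_pairingIn ℤ a b
    have hpair : P.pairingIn ℤ rb (s i) = P.pairingIn ℤ ra (s i) +
        ∑ k, (c k : ℤ) * P.pairingIn ℤ (s k) (s i) := by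
      have : ((P.pairingIn ℤ rb (s i) : ℤ) : ℂ) = ((P.pairingIn ℤ ra (s i) +
        ∑ k, (c k : ℤ) * P.pairingIn ℤ (s k) (s i) : ℤ) : ℂ) := by
        push_cast
        simp only [hp]
        have e' : P.root rb = P.root ra + ∑ j, (c j : ℂ) • P.root (s j) := by
          rw [hra, hrb, e]
          congr 1
        have h1 := congrArg (P.coroot' (s i)) e'
        simpa using h1
      exact_mod_cast this
    -- the decremented coefficients
    obtain ⟨c', hc'⟩ : ∃ c' : Fin D.n → ℕ, c = c' + Pi.single i 1 := by
      refine ⟨c - Pi.single i 1, ?_⟩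
      ext j
      by_cases hj : j = i
      · subst hj; simp; omega
      · simp [hj]
    have hcs : ∑ j, (c j : ℂ) • D.simple j = ∑ j, (c' j : ℂ) • D.simple j + D.simple i := by
      simp [hc', add_smul, Finset.sum_add_distrib, Pi.single_apply]
    have hc'N : ∑ j, c' j = N := by
      rw [hc'] at hc
      simp [Finset.sum_add_distrib] at hc
      exact hc
    have hzero : α ≠ 0 := fun h => D.zero_not_mem (h ▸ hα.1)
    by_cases hb : 0 < P.pairingIn ℤ rb (s i)
    · have hbi : rb ≠ s i := by
        intro h
        have h1 : β = D.simple i := by rw [← hrb, h, hs]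
        have h2 : ∑ j, (((d + c') j : ℕ) : ℂ) • D.simple j = ∑ j, ((0 : ℕ) : ℂ) • D.simple j := by
          rw [h1, hcs, hd, ← add_assoc] at e
          have e3 : D.simple i = D.simple i +
            (∑ j, (d j : ℂ) • D.simple j + ∑ j, (c' j : ℂ) • D.simple j) := e.trans (by abel)
          have e' := left_eq_add.1 e3
          simpa [add_smul, Finset.sum_add_distrib] using e'
        have h3 := D.hess_coeff (b := fun _ => 0) h2
        apply hzero
        rw [hd]
        refine Finset.sum_eq_zero fun j _ => ?_
        have := congrFun h3 j
        simp at this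
        simp [this.1]
      have hroot := D.hess_mem_of_range (P.root_sub_root_mem_of_pairingIn_pos hb hbi)
      rw [hrb, hs] at hroot
      have e2 : β - D.simple i = α + ∑ j, (c' j : ℂ) • D.simple j := by
        rw [e, hcs]; abel
      have hposr : β - D.simple i ∈ D.posRoots := by
        refine ⟨hroot, d + c', ?_⟩
        rw [e2, hd]
        simp [add_smul, Finset.sum_add_distrib]
      exact ih c' hc'N α hα _ hposr e2
        (D.hess_step H hmod hposr hβ (D.hess_simple_pos i) (by abel) hH)
    · have ha : P.pairingIn ℤ ra (s i) < 0 := by linarith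
      have hai : P.root ra ≠ - P.root (s i) := by
        rw [hra, hs]
        intro h
        have h2 : ∑ j, (((d + Pi.single i 1 : Fin D.n → ℕ) j : ℕ) : ℂ) • D.simple j =
            ∑ j, ((0 : ℕ) : ℂ) • D.simple j := by
          rw [hd] at h
          simp [add_smul, Finset.sum_add_distrib, Pi.single_apply, h]
        have h3 := congrFun (D.hess_coeff (b := fun _ => 0) h2) i
        simp at h3
      have hroot := D.hess_mem_of_range (P.root_add_root_mem_of_pairingIn_neg ha hai)
      rw [hra, hs] at hroot
      have hposr : α + D.simple i ∈ D.posRoots := by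
        refine ⟨hroot, d + Pi.single i 1, ?_⟩
        rw [hd]
        simp [add_smul, Finset.sum_add_distrib, Pi.single_apply]
      have h1 := ih c' hc'N _ hposr β hβ (by rw [e, hcs]; abel) hH
      exact D.hess_step H hmod hα hposr (D.hess_simple_pos i) rfl h1

end SemisimpleWithBase

/-- Every linear subspace `H ⊆ 𝔤` containing the Borel subalgebra `𝔟` and stable under
the adjoint action of `𝔟` (a Hessenberg space) has the form
`H = 𝔟 ⊕ ⊕_{α ∈ S} 𝔤_{-α}` for a subset `S ⊆ Φ⁺` which is a lower set for `⪯`: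
if `β ∈ S` and `α ∈ Φ⁺` with `α ⪯ β`, then `α ∈ S`. -/
theorem hessenberg_space_decomposition
    {L : Type} [LieRing L] [LieAlgebra ℂ L] [Module.Finite ℂ L]
    [LieAlgebra.IsSemisimple ℂ L] (D : SemisimpleWithBase L)
    (H : Submodule ℂ L) (hb : D.borel ≤ H)
    (hmod : ∀ x ∈ D.borel, ∀ y ∈ H, ⁅x, y⁆ ∈ H) :
    ∃ S : Set (Module.Dual ℂ D.cartan), S ⊆ D.posRoots ∧
      (∀ β ∈ S, ∀ α ∈ D.posRoots, D.precEq α β → α ∈ S) ∧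
      H = D.borel ⊔ ⨆ α ∈ S, eigSpace D.cartan (-α) := by
  refine ⟨{α | α ∈ D.posRoots ∧ eigSpace D.cartan (-α) ≤ H}, fun α h => h.1, ?_, ?_⟩
  · rintro β ⟨hβ, hβH⟩ α hα ⟨c, hc⟩
    exact ⟨hα, D.hess_lower H hmod _ c rfl α hα β hβ (by rw [← hc]; abel) hβH⟩
  · refine le_antisymm ?_ (sup_le hb (iSup₂_le fun α hα => hα.2))
    refine (D.hess_le H hmod).trans (iSup_le fun χ => ?_)
    by_cases h0 : χ = 0
    · subst h0
      rw [D.hess_zero]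
      exact inf_le_right.trans (D.hess_cartan_le_borel.trans le_sup_left)
    by_cases hbot : eigSpace D.cartan χ = ⊥
    · rw [hbot, inf_bot_eq]
      exact bot_le
    have hχ := D.hess_mem_roots h0 hbot
    rcases D.root_decomp χ hχ with hp | ⟨c, hc⟩
    · exact inf_le_right.trans ((D.hess_eig_le_borel ⟨hχ, hp⟩).trans le_sup_left)
    · rcases D.hess_le_or_disjoint hχ H with h | h
      · refine inf_le_right.trans (le_trans ?_ le_sup_right)
        refine le_iSup₂_of_le (f := fun α _ => eigSpace D.cartan (-α)) (-χ)
          ⟨⟨D.neg_mem _ hχ, c, by rw [hc, neg_neg]⟩, by rwa [neg_neg]⟩ ?_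
        rw [neg_neg]
      · rw [h]
        exact bot_le
end

section
/- Let S ⊆ Φ⁺ be a lower set for ⪯ (if β ∈ S and α ∈ Φ⁺ with α ⪯ β then α ∈ S), let H = 𝔟 ⊕ ⊕_{β∈S} 𝔤_{−β} be the corresponding Hessenberg space, let α be a maximal element of S with respect to ⪯, and set H' = 𝔟 ⊕ ⊕_{β∈S∖{α}} 𝔤_{−β}. Then: (i) [𝔟, H'] ⊆ H', so H' is again a 𝔟-submodule of 𝔤 containing 𝔟; (ii) [𝔫, H] ⊆ H'. Consequently the quotient 𝔟-module H/H' is one-dimensional, 𝔫 acts on it by zero, and every h ∈ 𝔥 acts on it by multiplication by −α(h); that is, the dual 𝔟-module (H/H')* is isomorphic to the one-dimensional 𝔟-module ℂ_α of weight α. -/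
namespace HessAux

variable {L : Type} [LieRing L] [LieAlgebra ℂ L] [Module.Finite ℂ L]
  [LieAlgebra.IsSemisimple ℂ L]

theorem lie_mem_eig {K : LieSubalgebra ℂ L} {μ ν : Module.Dual ℂ K} {x y : L}
    (hx : x ∈ eigSpace K μ) (hy : y ∈ eigSpace K ν) : ⁅x, y⁆ ∈ eigSpace K (μ + ν) := by
  intro h
  rw [leibniz_lie, hx h, hy h]
  simp [add_smul]

theorem eig_zero_le (D : SemisimpleWithBase L) :
    eigSpace D.cartan 0 ≤ D.cartan.toSubmodule := by
  intro x hx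
  have hn := D.isCartan.self_normalizing
  have : x ∈ D.cartan.normalizer := by
    rw [LieSubalgebra.mem_normalizer_iff']
    intro y hy
    have := hx ⟨y, hy⟩
    simp at this
    rw [this]
    exact D.cartan.zero_mem
  rw [hn] at this
  exact this

/-- the ambient independent family -/
theorem exists_family (D : SemisimpleWithBase L) :
    ∃ F : (D.cartan → ℂ) → Submodule ℂ L, iSupIndep F ∧
      D.cartan.toSubmodule ≤ F 0 ∧ ∀ μ : Module.Dual ℂ D.cartan, eigSpace D.cartan μ ≤ F μ := by
  haveI := D.isCartan
  haveI := D.isCartan.nilpotent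
  refine ⟨fun χ => (LieModule.genWeightSpace L χ : LieSubmodule ℂ D.cartan L).toSubmodule,
    ?_, ?_, ?_⟩
  · exact LieSubmodule.iSupIndep_toSubmodule.mpr (LieModule.iSupIndep_genWeightSpace ℂ D.cartan L)
  · exact LieAlgebra.toLieSubmodule_le_rootSpace_zero ℂ L D.cartan
  · intro μ x hx
    apply LieModule.weightSpace_le_genWeightSpace L (μ : D.cartan → ℂ)
    rw [LieModule.mem_weightSpace]
    intro h
    exact hx h

theorem eig_eq_bot (D : SemisimpleWithBase L) {μ : Module.Dual ℂ D.cartan}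
    (h0 : μ ≠ 0) (hr : μ ∉ D.roots) : eigSpace D.cartan μ = ⊥ := by
  obtain ⟨F, hF, hK, hE⟩ := exists_family D
  have hd := hF (μ : D.cartan → ℂ)
  have htop : (⨆ j, ⨆ (_ : j ≠ (μ : D.cartan → ℂ)), F j) = ⊤ := by
    rw [eq_top_iff, ← D.decomp]
    refine sup_le ?_ (iSup₂_le fun ν hν => ?_)
    · refine hK.trans (le_iSup₂_of_le 0 (fun h => h0 ?_) le_rfl)
      ext x; exact (congrFun h x).symm
    · refine (hE ν).trans (le_iSup₂_of_le (ν : D.cartan → ℂ) (fun h => hr ?_) le_rfl)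
      rw [← DFunLike.coe_injective h]; exact hν
  rw [htop, disjoint_top] at hd
  exact le_bot_iff.mp ((hE μ).trans hd.le)

theorem neg_ne (D : SemisimpleWithBase L) {β γ : Module.Dual ℂ D.cartan}
    (hβ : β ∈ D.posRoots) (hγ : γ ∈ D.posRoots) : β + γ ≠ 0 := by
  intro h
  obtain ⟨hr, c, rfl⟩ := hβ
  obtain ⟨-, d, rfl⟩ := hγ
  apply D.zero_not_mem
  rw [← Finset.sum_add_distrib] at h
  simp only [← add_smul] at h
  have := Fintype.linearIndependent_iff.mp D.simple_indep _ h
  have hc : ∀ i, c i = 0 := fun i => by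
    have := this i
    norm_cast at this
    omega
  simpa [hc] using hr

theorem pos_cases (D : SemisimpleWithBase L) {β : Module.Dual ℂ D.cartan}
    (hβ : β ∈ D.roots) : β ∈ D.posRoots ∨ -β ∈ D.posRoots := by
  rcases D.root_decomp β hβ with h | ⟨c, h⟩
  · exact Or.inl ⟨hβ, h⟩
  · exact Or.inr ⟨D.neg_mem β hβ, c, by rw [h, neg_neg]⟩

theorem sup_ind {M : Submodule ℂ L} {ι : Type} {p : Set ι} {f : ι → Submodule ℂ L}
    (g : L →ₗ[ℂ] L) (h : ∀ i ∈ p, ∀ y ∈ f i, g y ∈ M) :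
    ∀ y ∈ ⨆ i ∈ p, f i, g y ∈ M := by
  have : (⨆ i ∈ p, f i) ≤ M.comap g := iSup₂_le fun i hi y hy => h i hi y hy
  exact fun y hy => this hy

theorem sup_two {M A B : Submodule ℂ L}
    (g : L →ₗ[ℂ] L) (hA : ∀ y ∈ A, g y ∈ M) (hB : ∀ y ∈ B, g y ∈ M) :
    ∀ y ∈ A ⊔ B, g y ∈ M := by
  have : A ⊔ B ≤ M.comap g := sup_le hA hB
  exact fun y hy => this hy

end HessAux

/-- Let `S ⊆ Φ⁺` be a lower set, `H = 𝔟 ⊕ ⊕_{β ∈ S} 𝔤_{-β}` the corresponding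
Hessenberg space, `α` a maximal element of `S` with respect to `⪯`, and
`H' = 𝔟 ⊕ ⊕_{β ∈ S∖{α}} 𝔤_{-β}`.  Then:
(i) `[𝔟, H'] ⊆ H'`, so `H'` is again a `𝔟`-submodule of `𝔤` containing `𝔟`;
(ii) `[𝔫, H] ⊆ H'`.
Consequently `H/H'` is one-dimensional, `𝔫` acts on it by zero (which is (ii)), and
every `h ∈ 𝔥` acts on it by `-α(h)`, i.e. `[h, y] + α(h) y ∈ H'` for `y ∈ H`;
that is, the dual `𝔟`-module `(H/H')*` is the one-dimensional module `ℂ_α` of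
weight `α`. -/
theorem hessenberg_codim_one_quotient
    {L : Type} [LieRing L] [LieAlgebra ℂ L] [Module.Finite ℂ L]
    [LieAlgebra.IsSemisimple ℂ L] (D : SemisimpleWithBase L)
    (S : Set (Module.Dual ℂ D.cartan)) (hS : S ⊆ D.posRoots)
    (hlower : ∀ β ∈ S, ∀ γ ∈ D.posRoots, D.precEq γ β → γ ∈ S)
    (α : Module.Dual ℂ D.cartan) (hα : α ∈ S)
    (hmax : ∀ β ∈ S, D.precEq α β → β = α)
    (H H' : Submodule ℂ L)
    (hH : H = D.borel ⊔ ⨆ β ∈ S, eigSpace D.cartan (-β))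
    (hH' : H' = D.borel ⊔ ⨆ β ∈ S \ {α}, eigSpace D.cartan (-β)) :
    (∀ x ∈ D.borel, ∀ y ∈ H', ⁅x, y⁆ ∈ H') ∧
    (∀ x ∈ D.nilpos, ∀ y ∈ H, ⁅x, y⁆ ∈ H') ∧
    Module.finrank ℂ (H ⧸ H'.comap H.subtype) = 1 ∧
    (∀ h : D.cartan, ∀ y ∈ H, ⁅(h : L), y⁆ + α h • y ∈ H') := by
  have hKH' : D.cartan.toSubmodule ≤ H' := by
    rw [hH']; exact le_sup_left.trans le_sup_left
  have hNH' : ∀ β ∈ D.posRoots, eigSpace D.cartan β ≤ H' := fun β hβ => by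
    rw [hH']
    exact (le_iSup₂_of_le (f := fun β (_ : β ∈ D.posRoots) => eigSpace D.cartan β)
      β hβ le_rfl).trans (le_sup_right.trans le_sup_left)
  have hSH' : ∀ β ∈ S, β ≠ α → eigSpace D.cartan (-β) ≤ H' := fun β hβ hne => by
    rw [hH']
    exact (le_iSup₂_of_le (f := fun β (_ : β ∈ S \ {α}) => eigSpace D.cartan (-β))
      β ⟨hβ, hne⟩ le_rfl).trans le_sup_right
  have hHsup : H = H' ⊔ eigSpace D.cartan (-α) := by
    apply le_antisymm
    · rw [hH]
      refine sup_le ?_ (iSup₂_le fun β hβ => ?_)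
      · rw [hH']; exact le_sup_left.trans le_sup_left
      · by_cases h : β = α
        · rw [h]; exact le_sup_right
        · exact (hSH' β hβ h).trans le_sup_left
    · refine sup_le ?_ ?_
      · rw [hH, hH']
        exact sup_le_sup_left (biSup_mono fun β hβ => hβ.1) _
      · rw [hH]
        exact (le_iSup₂_of_le (f := fun β (_ : β ∈ S) => eigSpace D.cartan (-β))
          α hα le_rfl).trans le_sup_right
  have hle : H' ≤ H := hHsup ▸ le_sup_left
  -- brackets of root vectors
  have key : ∀ β ∈ D.posRoots, ∀ x ∈ eigSpace D.cartan β,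
      ∀ ν : Module.Dual ℂ D.cartan, (ν ∈ D.posRoots ∨ -ν ∈ S) →
      ∀ y ∈ eigSpace D.cartan ν, ⁅x, y⁆ ∈ H' := by
    intro β hβ x hx ν hν y hy
    have hxy := HessAux.lie_mem_eig hx hy
    by_cases h0 : β + ν = 0
    · rw [h0] at hxy
      exact hKH' (HessAux.eig_zero_le D hxy)
    by_cases hr : β + ν ∈ D.roots
    swap
    · rw [HessAux.eig_eq_bot D h0 hr, Submodule.mem_bot] at hxy
      rw [hxy]; exact H'.zero_mem
    obtain ⟨hβr, c, hc⟩ := hβ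
    rcases hν with ⟨hνr, d, hd⟩ | hν
    · refine hNH' _ ⟨hr, c + d, ?_⟩ hxy
      rw [hc, hd, ← Finset.sum_add_distrib]
      simp [add_smul]
    · rcases HessAux.pos_cases D hr with hp | hp
      · exact hNH' _ hp hxy
      · have hmem : -(β + ν) ∈ S := hlower _ hν _ hp ⟨c, by rw [← hc]; abel⟩
        have hne : -(β + ν) ≠ α := by
          intro he
          have := hmax _ hν ⟨c, by rw [← hc, ← he]; abel⟩
          apply D.zero_not_mem
          have hb : β = 0 := by
            have h2 : -(β + ν) = -ν := he.trans this.symm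
            have h3 : β + ν = ν := neg_injective h2
            simpa using h3
          rwa [← hb]
        have := hSH' _ hmem hne
        rw [neg_neg] at this
        exact this hxy
  have keyK : ∀ h : D.cartan, ∀ y ∈ H', ⁅(h : L), y⁆ ∈ H' := by
    intro h y hy
    have hy' := hy
    rw [hH'] at hy'
    refine HessAux.sup_two (LieAlgebra.ad ℂ L (h : L) : L →ₗ[ℂ] L) ?_ ?_ y hy'
    · refine HessAux.sup_two _ ?_ ?_
      · exact fun y hy => hKH' (D.cartan.lie_mem h.2 hy)
      · refine HessAux.sup_ind _ fun β hβ y hy => ?_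
        rw [LieAlgebra.ad_apply, hy h]
        exact H'.smul_mem _ (hNH' β hβ hy)
    · refine HessAux.sup_ind _ fun β hβ y hy => ?_
      rw [LieAlgebra.ad_apply, hy h]
      exact H'.smul_mem _ (hSH' β hβ.1 hβ.2 hy)
  have keyN : ∀ x ∈ D.nilpos, ∀ y ∈ H, ⁅x, y⁆ ∈ H' := by
    intro x hx y hy
    rw [hH] at hy
    have hskew : ∀ (a b : L), ⁅b, a⁆ ∈ H' → ⁅a, b⁆ ∈ H' := fun a b h => by
      rw [← lie_skew]; exact H'.neg_mem h
    apply hskew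
    refine HessAux.sup_ind (LieAlgebra.ad ℂ L y : L →ₗ[ℂ] L) (fun β hβ x hx => ?_) x hx
    rw [LieAlgebra.ad_apply]
    apply hskew
    refine HessAux.sup_two (LieAlgebra.ad ℂ L x : L →ₗ[ℂ] L) ?_ ?_ y hy
    · refine HessAux.sup_two _ ?_ ?_
      · intro k hk
        rw [LieAlgebra.ad_apply]
        apply hskew
        have := hx ⟨k, hk⟩
        simp only at this
        rw [this]
        exact H'.smul_mem _ (hNH' β hβ hx)
      · exact HessAux.sup_ind _ fun γ hγ y hy => key β hβ x hx γ (Or.inl hγ) y hy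
    · exact HessAux.sup_ind _ fun γ hγ y hy =>
        key β hβ x hx (-γ) (Or.inr (by rwa [neg_neg])) y hy
  have hdisj : Disjoint (eigSpace D.cartan (-α)) H' := by
    obtain ⟨F, hF, hK, hE⟩ := HessAux.exists_family D
    refine (hF ((-α : Module.Dual ℂ D.cartan) : D.cartan → ℂ)).mono (hE _) ?_
    have hαp := hS hα
    have hstep : ∀ ν : Module.Dual ℂ D.cartan, ν ≠ -α → eigSpace D.cartan ν ≤
        ⨆ j, ⨆ (_ : j ≠ ((-α : Module.Dual ℂ D.cartan) : D.cartan → ℂ)), F j :=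
      fun ν hν => (hE ν).trans (le_iSup₂_of_le (ν : D.cartan → ℂ)
        (fun h => hν (DFunLike.coe_injective h)) le_rfl)
    rw [hH']
    refine sup_le (sup_le ?_ (iSup₂_le fun β hβ => hstep β ?_))
      (iSup₂_le fun β hβ => hstep (-β) ?_)
    · refine hK.trans (le_iSup₂_of_le 0 (fun h => ?_) le_rfl)
      have h2 : (0 : Module.Dual ℂ D.cartan) = -α := by
        ext x; exact congrFun h x
      apply D.zero_not_mem
      have : α = 0 := neg_eq_zero.mp h2.symm
      rw [← this]; exact hαp.1
    · intro h
      exact HessAux.neg_ne D hβ hαp (by rw [h]; simp)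
    · exact fun h => hβ.2 (neg_injective h)
  refine ⟨?_, keyN, ?_, ?_⟩
  · intro x hx y hy
    obtain ⟨k, hk, n, hn, rfl⟩ := Submodule.mem_sup.mp hx
    rw [add_lie]
    exact H'.add_mem (keyK ⟨k, hk⟩ y hy) (keyN n hn y (hle hy))
  · obtain ⟨v, hv0, hv⟩ := finrank_eq_one_iff'.mp
      (D.finrank_eq_one (-α) (D.neg_mem α (hS hα).1))
    have hvH : (v : L) ∈ H := by
      rw [hHsup]; exact Submodule.mem_sup_right v.2
    refine finrank_eq_one (Submodule.Quotient.mk (⟨v, hvH⟩ : H)) ?_ ?_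
    · rw [Ne, Submodule.Quotient.mk_eq_zero]
      intro h
      exact hv0 (Subtype.ext (Submodule.disjoint_def.mp hdisj v v.2 h))
    · intro w
      obtain ⟨⟨w, hw⟩, rfl⟩ := Submodule.Quotient.mk_surjective _ w
      have hw' := hw
      rw [hHsup] at hw'
      obtain ⟨a, ha, b, hb, hab⟩ := Submodule.mem_sup.mp hw'
      obtain ⟨c, hc⟩ := hv ⟨b, hb⟩
      have hc' : c • (v : L) = b := congrArg Subtype.val hc
      refine ⟨c, ?_⟩
      rw [← Submodule.Quotient.mk_smul, Submodule.Quotient.eq, Submodule.mem_comap]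
      have : H.subtype (c • (⟨v, hvH⟩ : H) - ⟨w, hw⟩) = -a := by
        simp [hc', ← hab]
      rw [this]
      exact H'.neg_mem ha
  · intro h y hy
    rw [hHsup] at hy
    obtain ⟨a, ha, b, hb, rfl⟩ := Submodule.mem_sup.mp hy
    rw [lie_add, hb h]
    have : ⁅(h : L), a⁆ + (-α) h • b + α h • (a + b) = ⁅(h : L), a⁆ + α h • a := by
      simp only [LinearMap.neg_apply, neg_smul, smul_add]; abel
    rw [this]
    exact H'.add_mem (keyK h a ha) (H'.smul_mem _ ha)
end

section
/- Let J ⊆ {1,…,n} and let s ∈ 𝔥 be an element such that α(s) ≠ 0 for every positive root α ∉ Φ(J) (i.e., for every positive root whose expansion in simple roots involves some αᵢ with i ∉ J). Then for any scalars c₁,…,c_n ∈ ℂ there exists a Lie algebra automorphism φ of 𝔤, which can be taken to be a finite composition of automorphisms exp(ad u) with u lying in positive root spaces 𝔤_β (β ∈ Φ⁺), such that φ(s + Σᵢ₌₁ⁿ cᵢ Eᵢ) = s + Σ_{j∈J} cⱼ Eⱼ. -/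
/-- The exponential of a (nilpotent) endomorphism `f` of `L`:
`exp f = ∑_k f^k / k!` (the series terminates since `f` is nilpotent of index at most
`dim L`). -/
noncomputable def expEnd {L : Type} [LieRing L] [LieAlgebra ℂ L] [Module.Finite ℂ L]
    (f : Module.End ℂ L) : Module.End ℂ L :=
  ∑ k ∈ Finset.range (Module.finrank ℂ L + 1), (k.factorial : ℂ)⁻¹ • f ^ k

namespace TruncAux

variable {L : Type} [LieRing L] [LieAlgebra ℂ L] [Module.Finite ℂ L]

lemma lie_mem_eigSpace (K : LieSubalgebra ℂ L) {α β : Module.Dual ℂ K} {x y : L}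
    (hx : x ∈ eigSpace K α) (hy : y ∈ eigSpace K β) : ⁅x, y⁆ ∈ eigSpace K (α + β) := by
  intro h
  have h1 : ⁅(h : L), x⁆ = α h • x := hx h
  have h2 : ⁅(h : L), y⁆ = β h • y := hy h
  rw [leibniz_lie, h1, h2, smul_lie, lie_smul, LinearMap.add_apply, add_smul]

lemma eigSpace_le_rootSpace (K : LieSubalgebra ℂ L) [LieRing.IsNilpotent K]
    (α : Module.Dual ℂ K) {x : L} (hx : x ∈ eigSpace K α) :
    x ∈ LieAlgebra.rootSpace K (α : K → ℂ) := by
  apply LieModule.weightSpace_le_genWeightSpace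
  rw [LieModule.mem_weightSpace]
  intro h
  exact hx h

/-- A nonzero functional that is not a root has trivial eigenspace. -/
lemma eigSpace_eq_zero [LieAlgebra.IsSemisimple ℂ L] (D : SemisimpleWithBase L)
    {α : Module.Dual ℂ D.cartan} (h0 : α ≠ 0) (hα : α ∉ D.roots) {x : L}
    (hx : x ∈ eigSpace D.cartan α) : x = 0 := by
  have := D.isCartan
  have hind := LieModule.iSupIndep_genWeightSpace ℂ D.cartan L
  rw [← LieSubmodule.iSupIndep_toSubmodule] at hind
  have hd := hind (α : D.cartan → ℂ)
  rw [Submodule.disjoint_def] at hd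
  refine hd x (eigSpace_le_rootSpace _ _ hx) ?_
  have htop : x ∈ (⊤ : Submodule ℂ L) := trivial
  rw [← D.decomp] at htop
  revert htop
  refine fun h => SetLike.le_def.1 ?_ h
  refine sup_le ?_ ?_
  · intro y hy
    refine Submodule.mem_iSup_of_mem (0 : D.cartan → ℂ) (Submodule.mem_iSup_of_mem ?_ ?_)
    · intro h
      exact h0 (DFunLike.coe_injective h.symm)
    · exact LieAlgebra.toLieSubmodule_le_rootSpace_zero ℂ L D.cartan hy
  · refine iSup₂_le fun β hβ y hy => ?_
    refine Submodule.mem_iSup_of_mem (β : D.cartan → ℂ) (Submodule.mem_iSup_of_mem ?_ ?_)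
    · intro h
      exact hα (DFunLike.coe_injective h ▸ hβ)
    · exact eigSpace_le_rootSpace _ _ hy

lemma ad_nilp [LieAlgebra.IsSemisimple ℂ L] (D : SemisimpleWithBase L)
    {β : Module.Dual ℂ D.cartan} (hβ : β ∈ D.roots) {u : L} (hu : u ∈ eigSpace D.cartan β) :
    IsNilpotent (LieAlgebra.ad ℂ L u) := by
  have := D.isCartan
  refine LieAlgebra.isNilpotent_ad_of_mem_rootSpace D.cartan (χ := (β : D.cartan → ℂ)) ?_
    (eigSpace_le_rootSpace _ _ hu)
  intro h
  apply D.zero_not_mem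
  have : β = 0 := DFunLike.coe_injective h
  exact this ▸ hβ

lemma expEnd_eq [LieAlgebra ℚ L] (f : Module.End ℂ L) (hf : IsNilpotent f) : expEnd f = IsNilpotent.exp f := by
  have h : f ^ (Module.finrank ℂ L + 1) = 0 := by
    have h1 : f ^ Module.finrank ℂ L = 0 := by
      obtain ⟨m, hm⟩ := hf
      ext x
      have := Module.End.ker_pow_le_ker_pow_finrank f m (x := x) (by simp [hm])
      simpa using this
    rw [pow_succ, h1, zero_mul]
  rw [IsNilpotent.exp_eq_sum h, expEnd]
  refine Finset.sum_congr rfl fun k _ => ?_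
  ext x
  rw [LinearMap.smul_apply, LinearMap.smul_apply]
  have : ((k.factorial : ℚ)⁻¹ : ℚ) • ((f ^ k) x) = (((k.factorial : ℚ)⁻¹ : ℚ) : ℂ) • ((f ^ k) x) := by
    rw [Rat.cast_smul_eq_qsmul]
  rw [this]
  simp

/-- The rational structure on a complex Lie algebra. -/
@[reducible] noncomputable def ratLie (L : Type) [LieRing L] [LieAlgebra ℂ L] : LieAlgebra ℚ L where
  __ := Module.compHom L (algebraMap ℚ ℂ)
  lie_smul q x y := lie_smul (algebraMap ℚ ℂ q) x y

lemma expEnd_aut (u : L) (hu : IsNilpotent (LieAlgebra.ad ℂ L u)) :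
    Function.Bijective (expEnd (LieAlgebra.ad ℂ L u)) ∧
    ∀ x y : L, expEnd (LieAlgebra.ad ℂ L u) ⁅x, y⁆ =
      ⁅expEnd (LieAlgebra.ad ℂ L u) x, expEnd (LieAlgebra.ad ℂ L u) y⁆ := by
  let _ := ratLie L
  have hu' : IsNilpotent (LieDerivation.ad ℂ L u).toLinearMap := by
    rwa [LieDerivation.coe_ad_apply_eq_ad_apply]
  have key : ∀ x, expEnd (LieAlgebra.ad ℂ L u) x = LieDerivation.exp (LieDerivation.ad ℂ L u) hu' x := by
    intro x
    rw [expEnd_eq _ hu, LieDerivation.exp_map_apply, LieDerivation.coe_ad_apply_eq_ad_apply]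
  constructor
  · rw [show (expEnd (LieAlgebra.ad ℂ L u) : L → L) =
      LieDerivation.exp (LieDerivation.ad ℂ L u) hu' from funext key]
    exact (LieDerivation.exp (LieDerivation.ad ℂ L u) hu').bijective
  · intro x y
    rw [key, key, key, LieEquiv.map_lie]

lemma expEnd_sub_mem (f : Module.End ℂ L) (V : Submodule ℂ L) (hV : ∀ v ∈ V, f v ∈ V) {x : L}
    (hx : f x ∈ V) : expEnd f x - x ∈ V := by
  have hk : ∀ k, (f ^ (k + 1)) x ∈ V := by
    intro k
    induction k with
    | zero => simpa using hx
    | succ k ih =>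
      rw [pow_succ', Module.End.mul_apply]
      exact hV _ ih
  rw [expEnd, Finset.sum_range_succ', LinearMap.add_apply, LinearMap.sum_apply]
  simp only [pow_zero, Nat.factorial_zero, Nat.cast_one, inv_one, one_smul, Module.End.one_apply,
    add_sub_cancel_right]
  exact Submodule.sum_mem _ fun k _ => V.smul_mem _ (hk k)

lemma expEnd_of_sq (f : Module.End ℂ L) {x : L} (hx : f (f x) = 0) : expEnd f x = x + f x := by
  rcases subsingleton_or_nontrivial L with h | h
  · exact Subsingleton.elim _ _
  have hpos : 0 < Module.finrank ℂ L := Module.finrank_pos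
  obtain ⟨m, hm⟩ : ∃ m, Module.finrank ℂ L = m + 1 := ⟨_, (Nat.succ_pred_eq_of_pos hpos).symm⟩
  have hk : ∀ k, (f ^ (k + 2)) x = 0 := by
    intro k
    rw [pow_add, Module.End.mul_apply, pow_two, Module.End.mul_apply, hx, map_zero]
  rw [expEnd, hm, Finset.sum_range_succ', Finset.sum_range_succ']
  simp only [LinearMap.add_apply, LinearMap.sum_apply, LinearMap.smul_apply]
  rw [Finset.sum_eq_zero fun k _ => by rw [show k + 1 + 1 = k + 2 from rfl, hk, smul_zero]]
  simp [add_comm]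

variable [LieAlgebra.IsSemisimple ℂ L] (D : SemisimpleWithBase L)

/-- The weight attached to a tuple of coefficients. -/
def wt (c : Fin D.n → ℕ) : Module.Dual ℂ D.cartan := ∑ i, (c i : ℂ) • D.simple i

lemma wt_add (c d : Fin D.n → ℕ) : wt D (c + d) = wt D c + wt D d := by
  simp [wt, add_smul, Finset.sum_add_distrib]

lemma wt_single (i : Fin D.n) : wt D (Pi.single i 1) = D.simple i := by
  rw [wt, Finset.sum_eq_single i]
  · simp
  · intro j _ hj
    simp [Pi.single_eq_of_ne hj]
  · simp

lemma exists_coord : ∃ g : Module.Dual ℂ D.cartan →ₗ[ℂ] (Fin D.n → ℂ),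
    (∀ i, g (D.simple i) = Pi.single i 1) ∧ ∀ c : Fin D.n → ℕ, g (wt D c) = fun i => (c i : ℂ) := by
  have hinj : LinearMap.ker (Fintype.linearCombination ℂ D.simple) = ⊥ :=
    LinearMap.ker_eq_bot.2 D.simple_indep.fintypeLinearCombination_injective
  obtain ⟨g, hg⟩ := LinearMap.exists_leftInverse_of_injective _ hinj
  have h1 : ∀ i, g (D.simple i) = Pi.single i 1 := by
    intro i
    have := LinearMap.congr_fun hg (Pi.single i 1)
    simpa [Fintype.linearCombination_apply_single] using this
  refine ⟨g, h1, fun c => ?_⟩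
  have := LinearMap.congr_fun hg (fun i => (c i : ℂ))
  simpa [Fintype.linearCombination_apply, wt] using this

lemma wt_not_mem_span (J : Finset (Fin D.n)) {c : Fin D.n → ℕ} {i : Fin D.n} (hi : i ∉ J)
    (hc : c i ≠ 0) : wt D c ∉ Submodule.span ℤ (D.simple '' (J : Set (Fin D.n))) := by
  obtain ⟨g, hg, hgc⟩ := exists_coord D
  intro h
  have : g (wt D c) i = 0 := by
    generalize wt D c = α at h
    induction h using Submodule.span_induction with
    | mem x hx =>
      obtain ⟨j, hj, rfl⟩ := hx
      rw [hg, Pi.single_eq_of_ne]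
      rintro rfl
      exact hi hj
    | zero => simp
    | add x y _ _ hx hy => simp [hx, hy]
    | smul a x _ hx => simp [hx]
  rw [hgc] at this
  exact hc (Nat.cast_eq_zero.1 this)

lemma wt_ne_zero {c : Fin D.n → ℕ} {i : Fin D.n} (hc : c i ≠ 0) : wt D c ≠ 0 := by
  intro h
  exact wt_not_mem_span D ∅ (i := i) (by simp) hc (h ▸ Submodule.zero_mem _)

/-- The height filtration on the sum of the positive root spaces outside `Φ(J)`. -/
def V (J : Finset (Fin D.n)) (k : ℕ) : Submodule ℂ L :=
  ⨆ c : {c : Fin D.n → ℕ // (∃ i, i ∉ J ∧ c i ≠ 0) ∧ k ≤ ∑ i, c i}, eigSpace D.cartan (wt D c)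

lemma mem_V (J : Finset (Fin D.n)) {k : ℕ} {c : Fin D.n → ℕ} (h1 : ∃ i, i ∉ J ∧ c i ≠ 0)
    (h2 : k ≤ ∑ i, c i) {x : L} (hx : x ∈ eigSpace D.cartan (wt D c)) : x ∈ V D J k :=
  Submodule.mem_iSup_of_mem (p := fun c : {c : Fin D.n → ℕ // (∃ i, i ∉ J ∧ c i ≠ 0) ∧
    k ≤ ∑ i, c i} => eigSpace D.cartan (wt D c)) ⟨c, h1, h2⟩ hx

lemma sum_pos' {c : Fin D.n → ℕ} {i : Fin D.n} (hc : c i ≠ 0) : 1 ≤ ∑ i, c i :=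
  (Nat.one_le_iff_ne_zero.2 hc).trans (Finset.single_le_sum (f := c) (fun _ _ => Nat.zero_le _)
    (Finset.mem_univ i))

lemma lie_mem_V (J : Finset (Fin D.n)) {k : ℕ} {c : Fin D.n → ℕ} (h1 : ∃ i, i ∉ J ∧ c i ≠ 0)
    {u : L} (hu : u ∈ eigSpace D.cartan (wt D c)) {x : L} (hx : x ∈ V D J k) :
    ⁅u, x⁆ ∈ V D J (k + 1) := by
  obtain ⟨i, hi, hci⟩ := h1
  induction hx using Submodule.iSup_induction' with
  | mem d x hx =>
    refine mem_V D J (c := c + d) ⟨i, hi, by simp [hci]⟩ ?_ ?_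
    · have := sum_pos' D hci
      have := d.2.2
      simp only [Pi.add_apply, Finset.sum_add_distrib]
      omega
    · rw [wt_add]
      exact lie_mem_eigSpace _ hu hx
  | zero => simp
  | add x y _ _ hx hy =>
    rw [lie_add]
    exact Submodule.add_mem _ hx hy

lemma V_anti (J : Finset (Fin D.n)) (k : ℕ) : V D J (k + 1) ≤ V D J k := by
  refine iSup_le fun c x hx => mem_V D J c.2.1 ?_ hx
  have := c.2.2
  omega

lemma V_eventually (J : Finset (Fin D.n)) : ∃ N, V D J N = ⊥ := by
  obtain ⟨g, -, hg⟩ := exists_coord D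
  obtain ⟨N, hN⟩ := exists_nat_gt (∑ α ∈ D.roots, ‖∑ i, g α i‖)
  refine ⟨N, ?_⟩
  rw [eq_bot_iff]
  refine iSup_le fun c x hx => ?_
  obtain ⟨⟨i, hi, hci⟩, hc⟩ := c.2
  refine (Submodule.mem_bot _).2 (eigSpace_eq_zero D (wt_ne_zero D hci) ?_ hx)
  intro hr
  have h1 := Finset.single_le_sum (f := fun α => ‖∑ i, g α i‖) (fun _ _ => norm_nonneg _) hr
  have h2 : ‖∑ i, g (wt D c) i‖ = ((∑ i, (c : Fin D.n → ℕ) i : ℕ) : ℝ) := by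
    rw [hg]
    rw [← Nat.cast_sum, Complex.norm_natCast]
  have h3 : (N : ℝ) ≤ ((∑ i, (c : Fin D.n → ℕ) i : ℕ) : ℝ) := by exact_mod_cast hc
  rw [h2] at h1
  linarith

/-- `x` can be moved to `t` by a composition of positive root exponentials. -/
def Good (t x : L) : Prop :=
  ∃ l : List L, (∀ u ∈ l, ∃ β ∈ D.posRoots, u ∈ eigSpace D.cartan β) ∧
    (l.map fun u => expEnd (LieAlgebra.ad ℂ L u)).prod x = t

lemma Good.step {t x u : L} {β : Module.Dual ℂ D.cartan} (hβ : β ∈ D.posRoots)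
    (hu : u ∈ eigSpace D.cartan β) (h : Good D t (expEnd (LieAlgebra.ad ℂ L u) x)) :
    Good D t x := by
  obtain ⟨l, hl, h⟩ := h
  refine ⟨l ++ [u], ?_, ?_⟩
  · intro v hv
    rcases List.mem_append.1 hv with hv | hv
    · exact hl v hv
    · rw [List.mem_singleton.1 hv]
      exact ⟨β, hβ, hu⟩
  · simpa using h

lemma good_main (J : Finset (Fin D.n)) (s : D.cartan)
    (hs : ∀ α ∈ D.posRoots,
      α ∉ Submodule.span ℤ (D.simple '' (J : Set (Fin D.n))) → α s ≠ 0) (e : L)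
    (he : ∀ (k : ℕ) (c : Fin D.n → ℕ), (∃ i, i ∉ J ∧ c i ≠ 0) → k ≤ ∑ i, c i →
      ∀ u ∈ eigSpace D.cartan (wt D c), ⁅u, e⁆ ∈ V D J (k + 1))
    (k : ℕ) (hk : ∀ z ∈ V D J (k + 1), Good D (s + e) (s + e + z)) :
    ∀ z ∈ V D J k, Good D (s + e) (s + e + z) := by
  have key : ∀ w ∈ V D J k, ∀ w' ∈ V D J k,
      (∀ z ∈ V D J (k + 1), Good D (s + e) (s + e + w' + z)) →
      ∀ z ∈ V D J (k + 1), Good D (s + e) (s + e + (w' + w) + z) := by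
    intro w hw
    induction hw using Submodule.iSup_induction' with
    | mem c w hw =>
      intro w' hw' H z hz
      obtain ⟨c, hcJ, hck⟩ := c
      simp only at hw
      have hwne : wt D c ≠ 0 := by
        obtain ⟨i, -, hi⟩ := hcJ
        exact wt_ne_zero D hi
      by_cases hr : wt D c ∈ D.roots
      · have hpos : wt D c ∈ D.posRoots := ⟨hr, c, rfl⟩
        have hsne : wt D c s ≠ 0 := by
          obtain ⟨i, hiJ, hi⟩ := hcJ
          exact hs _ hpos (wt_not_mem_span D J hiJ hi)
        set a := wt D c s with ha
        set u : L := a⁻¹ • w with hu_def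
        have hu : u ∈ eigSpace D.cartan (wt D c) := Submodule.smul_mem _ _ hw
        set f := LieAlgebra.ad ℂ L u with hf
        have hfV : ∀ j, ∀ v ∈ V D J j, f v ∈ V D J (j + 1) := fun j v hv =>
          lie_mem_V D J hcJ hu hv
        have hfV1 : ∀ v ∈ V D J (k + 1), f v ∈ V D J (k + 1) := fun v hv =>
          V_anti D J _ (hfV _ v hv)
        have hfs : f s = -w := by
          have h1 : ⁅(s : L), u⁆ = a • u := hu s
          rw [hf, LieAlgebra.ad_apply, ← lie_skew, h1, hu_def, smul_inv_smul₀ hsne]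
        have hffs : f (f s) = 0 := by
          rw [hfs, hf, LieAlgebra.ad_apply, hu_def]
          simp
        have e1 : expEnd f (s : L) = s - w := by
          rw [expEnd_of_sq f hffs, hfs, sub_eq_add_neg]
        have hwV : w ∈ V D J k := mem_V D J hcJ hck hw
        have e2 := expEnd_sub_mem f _ hfV1 (he k c hcJ hck u hu : f e ∈ V D J (k + 1))
        have e3 := expEnd_sub_mem f _ hfV1 (hfV k _ (Submodule.add_mem _ hw' hwV))
        have e4 := expEnd_sub_mem f _ hfV1 (hfV1 z hz)
        refine Good.step D hpos hu ?_
        have := H _ (Submodule.add_mem _ (Submodule.add_mem _ (Submodule.add_mem _ e2 e3) e4) hz)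
        convert this using 1
        rw [← hf, map_add, map_add, map_add, e1]
        abel
      · have : w = 0 := eigSpace_eq_zero D hwne hr hw
        rw [this, add_zero]
        exact H z hz
    | zero =>
      intro w' hw' H z hz
      rw [add_zero]
      exact H z hz
    | add x y hx hy ihx ihy =>
      intro w' hw' H z hz
      rw [← add_assoc w']
      exact ihy _ (Submodule.add_mem _ hw' hx) (ihx w' hw' H) z hz
  intro z hz
  have := key z hz 0 (Submodule.zero_mem _) (by simpa using hk) 0 (Submodule.zero_mem _)
  simpa using this

lemma good_zero (J : Finset (Fin D.n)) (s : D.cartan)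
    (hs : ∀ α ∈ D.posRoots,
      α ∉ Submodule.span ℤ (D.simple '' (J : Set (Fin D.n))) → α s ≠ 0) (e : L)
    (he : ∀ (k : ℕ) (c : Fin D.n → ℕ), (∃ i, i ∉ J ∧ c i ≠ 0) → k ≤ ∑ i, c i →
      ∀ u ∈ eigSpace D.cartan (wt D c), ⁅u, e⁆ ∈ V D J (k + 1)) :
    ∀ z ∈ V D J 0, Good D (s + e) (s + e + z) := by
  obtain ⟨N, hN⟩ := V_eventually D J
  have h0 : ∀ z ∈ V D J N, Good D (s + e) (s + e + z) := by
    intro z hz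
    rw [hN, Submodule.mem_bot] at hz
    exact ⟨[], by simp, by simp [hz]⟩
  clear hN
  induction N with
  | zero => exact h0
  | succ N ih => exact ih (good_main D J s hs e he N h0)

lemma list_aut (l : List L) (hl : ∀ u ∈ l, ∃ β ∈ D.posRoots, u ∈ eigSpace D.cartan β) :
    Function.Bijective (l.map fun u => expEnd (LieAlgebra.ad ℂ L u)).prod ∧
    ∀ x y : L, (l.map fun u => expEnd (LieAlgebra.ad ℂ L u)).prod ⁅x, y⁆ =
      ⁅(l.map fun u => expEnd (LieAlgebra.ad ℂ L u)).prod x,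
        (l.map fun u => expEnd (LieAlgebra.ad ℂ L u)).prod y⁆ := by
  induction l with
  | nil => exact ⟨Function.bijective_id, by simp⟩
  | cons u l ih =>
    obtain ⟨h1, h2⟩ := ih fun v hv => hl v (List.mem_cons_of_mem _ hv)
    obtain ⟨β, hβ, hu⟩ := hl u List.mem_cons_self
    obtain ⟨h3, h4⟩ := expEnd_aut u (ad_nilp D hβ.1 hu)
    rw [List.map_cons, List.prod_cons]
    refine ⟨?_, fun x y => ?_⟩
    · rw [Module.End.mul_eq_comp, LinearMap.coe_comp]
      exact h3.comp h1
    · simp only [Module.End.mul_apply, h2, h4]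

end TruncAux

/-- Let `J ⊆ {1, …, n}` and let `s ∈ 𝔥` be such that `α(s) ≠ 0` for every positive root
`α` not lying in `Φ(J)`, the set of roots in the `ℤ`-span of the simple roots `αⱼ`,
`j ∈ J`.  Then for any scalars `c 1, …, c n` there is a Lie algebra automorphism `φ`
of `𝔤`, which can be taken to be a finite composition of automorphisms `exp (ad u)`
with `u` lying in positive root spaces, such that
`φ (s + ∑ i, c i • E i) = s + ∑_{j ∈ J}, c j • E j`. -/
theorem exists_automorphism_truncating
    {L : Type} [LieRing L] [LieAlgebra ℂ L] [Module.Finite ℂ L]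
    [LieAlgebra.IsSemisimple ℂ L] (D : SemisimpleWithBase L)
    (E : Fin D.n → L) (hE : ∀ i, E i ∈ eigSpace D.cartan (D.simple i))
    (hE0 : ∀ i, E i ≠ 0)
    (J : Finset (Fin D.n)) (s : D.cartan)
    (hs : ∀ α ∈ D.posRoots,
      α ∉ Submodule.span ℤ (D.simple '' (J : Set (Fin D.n))) → α s ≠ 0)
    (c : Fin D.n → ℂ) :
    ∃ φ : Module.End ℂ L,
      (∃ (m : ℕ) (u : Fin m → L),
        (∀ k, ∃ β ∈ D.posRoots, u k ∈ eigSpace D.cartan β) ∧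
        φ = (List.ofFn fun k => expEnd (LieAlgebra.ad ℂ L (u k))).prod) ∧
      Function.Bijective φ ∧
      (∀ x y : L, φ ⁅x, y⁆ = ⁅φ x, φ y⁆) ∧
      φ ((s : L) + ∑ i, c i • E i) = (s : L) + ∑ j ∈ J, c j • E j := by
  set e : L := ∑ j ∈ J, c j • E j with he_def
  have hEw : ∀ i, E i ∈ eigSpace D.cartan (TruncAux.wt D (Pi.single i 1)) := fun i => by
    rw [TruncAux.wt_single]
    exact hE i
  have he : ∀ (k : ℕ) (d : Fin D.n → ℕ), (∃ i, i ∉ J ∧ d i ≠ 0) → k ≤ ∑ i, d i →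
      ∀ u ∈ eigSpace D.cartan (TruncAux.wt D d), ⁅u, e⁆ ∈ TruncAux.V D J (k + 1) := by
    intro k d hd hk u hu
    obtain ⟨i, hi, hdi⟩ := hd
    rw [he_def, lie_sum]
    refine Submodule.sum_mem _ fun j _ => ?_
    rw [lie_smul]
    refine Submodule.smul_mem _ _ ?_
    refine TruncAux.mem_V D J (c := d + Pi.single j 1) ⟨i, hi, by simp [hdi]⟩ ?_ ?_
    · simp only [Pi.add_apply, Finset.sum_add_distrib]
      simpa using hk
    · rw [TruncAux.wt_add]
      exact TruncAux.lie_mem_eigSpace _ hu (hEw j)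
  have hz : ∑ i ∈ Jᶜ, c i • E i ∈ TruncAux.V D J 0 := by
    refine Submodule.sum_mem _ fun j hj => Submodule.smul_mem _ _ ?_
    exact TruncAux.mem_V D J (c := Pi.single j 1) ⟨j, by simpa using hj, by simp⟩
      (Nat.zero_le _) (hEw j)
  obtain ⟨l, hl, h⟩ := TruncAux.good_zero D J s hs e he _ hz
  obtain ⟨h1, h2⟩ := TruncAux.list_aut D l hl
  refine ⟨_, ⟨l.length, l.get, fun k => hl _ (List.get_mem l k), ?_⟩, h1, h2, ?_⟩
  · congr 1
    conv_lhs => rw [← List.ofFn_get l]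
    rw [List.map_ofFn]
    rfl
  · rw [← h, add_assoc, he_def, Finset.sum_add_sum_compl]
end

section
/- Let J ⊆ {1,…,n} and let s ∈ 𝔥 be an element such that α(s) ≠ 0 for every positive root α ∉ Φ(J). Set x_J = s + Σ_{j∈J} Eⱼ and N₀ = Σᵢ₌₁ⁿ Eᵢ, and for t ∈ ℂ let x(t) = t·x_J + (1−t)·N₀. Then for every t ∈ ℂ with t ≠ 0 there exists a Lie algebra automorphism φ of 𝔤 such that φ(x(t)) = t·x_J. -/
namespace LineElt

variable {L : Type} [LieRing L] [LieAlgebra ℂ L] [Module.Finite ℂ L]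
  [LieAlgebra.IsSemisimple ℂ L]

theorem cartan_comm (D : SemisimpleWithBase L) (a b : D.cartan) : ⁅(a : L), (b : L)⁆ = 0 := by
  have := D.isCartan
  have h : ⁅a, b⁆ = 0 := LieModule.IsTrivial.trivial a b
  have := congrArg (fun x : D.cartan => (x : L)) h
  simpa using this

theorem eig_indep (D : SemisimpleWithBase L) :
    iSupIndep (fun α : Module.Dual ℂ D.cartan => eigSpace D.cartan α) := by
  have := D.isCartan
  have h1 := LieModule.iSupIndep_genWeightSpace ℂ D.cartan L
  rw [← LieSubmodule.iSupIndep_toSubmodule] at h1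
  have h2 := h1.comp (f := fun α : Module.Dual ℂ D.cartan => (α : D.cartan → ℂ))
    DFunLike.coe_injective
  refine h2.mono fun α x hx => ?_
  refine LieModule.weightSpace_le_genWeightSpace L _ ?_
  rw [LieModule.mem_weightSpace]
  exact fun h => hx h

theorem cartan_le (D : SemisimpleWithBase L) : D.cartan.toSubmodule ≤ eigSpace D.cartan 0 := by
  intro x hx h
  simpa using cartan_comm D h ⟨x, hx⟩

theorem eig_root (D : SemisimpleWithBase L) (α : Module.Dual ℂ D.cartan)
    (h : eigSpace D.cartan α ≠ ⊥) : α = 0 ∨ α ∈ D.roots := by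
  by_contra! hc
  apply h
  have h1 := eig_indep D α
  have h2 : (⨆ (β) (_ : β ≠ α), eigSpace D.cartan β) = ⊤ := by
    rw [eq_top_iff, ← D.decomp]
    refine sup_le ((cartan_le D).trans ?_) (iSup₂_le fun β hβ => ?_)
    · exact le_iSup₂_of_le (f := fun β (_ : β ≠ α) => eigSpace D.cartan β) 0 (Ne.symm hc.1) le_rfl
    · exact le_iSup₂_of_le (f := fun β (_ : β ≠ α) => eigSpace D.cartan β) β
        (fun e => hc.2 (e ▸ hβ)) le_rfl
  rw [h2] at h1
  exact disjoint_top.mp h1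

/-- dual elements -/
theorem exists_elt (D : SemisimpleWithBase L) (f : Fin D.n → ℂ) :
    ∃ h : D.cartan, ∀ i, D.simple i h = f i := by
  let T : D.cartan →ₗ[ℂ] (Fin D.n → ℂ) := LinearMap.pi D.simple
  have hT : LinearMap.range T = ⊤ := by
    by_contra hne
    obtain ⟨g, hg, hg'⟩ := Submodule.exists_le_ker_of_lt_top _ (lt_top_iff_ne_top.mpr hne)
    apply hg
    have key : ∑ i, g (Pi.single i 1) • D.simple i = 0 := by
      ext h
      have : g (T h) = 0 := hg' ⟨h, rfl⟩
      rw [LinearMap.pi_apply_eq_sum_univ g] at this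
      have e : ∀ i : Fin D.n, (fun j => if i = j then (1 : ℂ) else 0) = Pi.single i 1 := by
        intro i
        funext j
        simp [Pi.single_apply, eq_comm]
      simp only [e] at this
      simpa [T, mul_comm] using this
    have h0 := Fintype.linearIndependent_iff.mp D.simple_indep _ key
    ext i
    simpa using h0 i
  obtain ⟨h, hh⟩ := LinearMap.range_eq_top.mp hT f
  exact ⟨h, fun i => congrFun hh i⟩

/-- the functional with integer coordinates `c` -/
def wt (D : SemisimpleWithBase L) (c : Fin D.n → ℤ) : Module.Dual ℂ D.cartan :=
  ∑ i, (c i : ℂ) • D.simple i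

theorem wt_add (D : SemisimpleWithBase L) (c d : Fin D.n → ℤ) :
    wt D (c + d) = wt D c + wt D d := by
  simp [wt, add_smul, Finset.sum_add_distrib]

theorem wt_zero (D : SemisimpleWithBase L) : wt D 0 = 0 := by simp [wt]

theorem wt_single (D : SemisimpleWithBase L) (j : Fin D.n) :
    wt D (Pi.single j 1) = D.simple j := by
  simp [wt, Pi.single_apply]

theorem wt_inj (D : SemisimpleWithBase L) : Function.Injective (wt D) := by
  intro c d h
  ext i
  have h1 : ∑ i, ((c i : ℂ) - d i) • D.simple i = 0 := by
    simp only [sub_smul, Finset.sum_sub_distrib]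
    exact sub_eq_zero.mpr h
  have := Fintype.linearIndependent_iff.mp D.simple_indep _ h1 i
  exact_mod_cast sub_eq_zero.mp this

theorem lie_eig (D : SemisimpleWithBase L) {α β : Module.Dual ℂ D.cartan} {x y : L}
    (hx : x ∈ eigSpace D.cartan α) (hy : y ∈ eigSpace D.cartan β) :
    ⁅x, y⁆ ∈ eigSpace D.cartan (α + β) := by
  intro h
  rw [leibniz_lie, hx h, hy h]
  simp [add_smul]

/-- sum of weight spaces with weights satisfying `P` -/
def S (D : SemisimpleWithBase L) (P : (Fin D.n → ℤ) → Prop) : Submodule ℂ L :=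
  ⨆ (c) (_ : P c), eigSpace D.cartan (wt D c)

theorem mem_S (D : SemisimpleWithBase L) {P : (Fin D.n → ℤ) → Prop} {c} (hc : P c) {x : L}
    (hx : x ∈ eigSpace D.cartan (wt D c)) : x ∈ S D P :=
  Submodule.mem_iSup_of_mem c (Submodule.mem_iSup_of_mem hc hx)

theorem S_le (D : SemisimpleWithBase L) {P : (Fin D.n → ℤ) → Prop} {M : Submodule ℂ L}
    (h : ∀ c, P c → eigSpace D.cartan (wt D c) ≤ M) : S D P ≤ M := iSup₂_le h

theorem S_mono (D : SemisimpleWithBase L) {P Q : (Fin D.n → ℤ) → Prop}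
    (h : ∀ c, P c → Q c) : S D P ≤ S D Q := S_le D fun c hc _ hx => mem_S D (h c hc) hx

theorem lie_S (D : SemisimpleWithBase L) {P Q R : (Fin D.n → ℤ) → Prop}
    (h : ∀ c d, P c → Q d → R (c + d)) {x y : L} (hx : x ∈ S D P) (hy : y ∈ S D Q) :
    ⁅x, y⁆ ∈ S D R := by
  have h1 : S D P ≤ (S D R).comap (LinearMap.flip (LieModule.toEnd ℂ L L : L →ₗ[ℂ] L →ₗ[ℂ] L) y) := by
    refine S_le D fun c hc x hx => ?_
    have h2 : S D Q ≤ (S D R).comap (LieModule.toEnd ℂ L L x) := by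
      refine S_le D fun d hd y hy => ?_
      refine mem_S D (h c d hc hd) ?_
      rw [wt_add]
      exact lie_eig D hx hy
    exact h2 hy
  exact h1 hx

theorem root_wt (D : SemisimpleWithBase L) {α} (h : α ∈ D.roots) : ∃ c, α = wt D c := by
  rcases D.root_decomp α h with ⟨c, hc⟩ | ⟨c, hc⟩
  · exact ⟨fun i => c i, by simp [wt, hc]⟩
  · exact ⟨fun i => -c i, by simp [wt, hc]⟩

theorem S_top (D : SemisimpleWithBase L) : S D (fun _ => True) = ⊤ := by
  rw [eq_top_iff, ← D.decomp]
  refine sup_le ((cartan_le D).trans ?_) (iSup₂_le fun β hβ => ?_)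
  · rw [← wt_zero]
    exact fun x hx => mem_S D trivial hx
  · obtain ⟨c, rfl⟩ := root_wt D hβ
    exact fun x hx => mem_S D trivial hx

theorem exists_bound (D : SemisimpleWithBase L) :
    ∃ K : ℕ, ∀ c, eigSpace D.cartan (wt D c) ≠ ⊥ → |∑ i, c i| < K := by
  have hfin : {c | eigSpace D.cartan (wt D c) ≠ ⊥}.Finite := by
    refine Set.Finite.of_finite_image (f := wt D) ?_ (wt_inj D).injOn
    refine ((D.roots.finite_toSet).insert 0).subset ?_
    rintro _ ⟨c, hc, rfl⟩
    exact eig_root D _ hc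
  obtain ⟨K, hK⟩ := (hfin.image fun c => (|∑ i, c i|).toNat).bddAbove
  refine ⟨K + 1, fun c hc => ?_⟩
  have := hK ⟨c, hc, rfl⟩
  simp only at this
  omega

theorem S_bot (D : SemisimpleWithBase L) {P : (Fin D.n → ℤ) → Prop}
    (h : ∀ c, P c → eigSpace D.cartan (wt D c) = ⊥) : S D P = ⊥ :=
  le_bot_iff.mp (S_le D fun c hc => (h c hc).le)

/-- positive height ideal filtration -/
def F (D : SemisimpleWithBase L) (J : Finset (Fin D.n)) (k : ℕ) : Submodule ℂ L :=
  S D fun c => (∀ i, 0 ≤ c i) ∧ (∃ i, i ∉ J ∧ c i ≠ 0) ∧ (k : ℤ) ≤ ∑ i, c i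

theorem F_anti (D : SemisimpleWithBase L) (J : Finset (Fin D.n)) {k l : ℕ} (h : k ≤ l) :
    F D J l ≤ F D J k :=
  S_mono D fun c hc => ⟨hc.1, hc.2.1, by have := hc.2.2; omega⟩

theorem lie_F (D : SemisimpleWithBase L) (J : Finset (Fin D.n)) {k l : ℕ} {x y : L}
    (hx : x ∈ F D J k) (hy : y ∈ F D J l) : ⁅x, y⁆ ∈ F D J (k + l) := by
  refine lie_S D (fun c d hc hd => ⟨fun i => add_nonneg (hc.1 i) (hd.1 i), ?_, ?_⟩) hx hy
  · obtain ⟨i, hi, hi'⟩ := hc.2.1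
    refine ⟨i, hi, ?_⟩
    have := hc.1 i
    have := hd.1 i
    simp only [Pi.add_apply]
    omega
  · have := hc.2.2
    have := hd.2.2
    simp only [Pi.add_apply, Finset.sum_add_distrib]
    push_cast
    omega

theorem lie_F_E (D : SemisimpleWithBase L) (J : Finset (Fin D.n)) {k : ℕ} {x e : L} (j : Fin D.n)
    (hx : x ∈ F D J k) (he : e ∈ eigSpace D.cartan (D.simple j)) : ⁅x, e⁆ ∈ F D J (k + 1) := by
  have he' : e ∈ S D (fun c => c = Pi.single j 1) := by
    refine mem_S D (P := fun c => c = Pi.single j 1) (c := Pi.single j 1) rfl ?_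
    rw [wt_single]
    exact he
  refine lie_S D (fun c d hc hd => ?_) hx he'
  subst hd
  have hn : ∀ i, 0 ≤ (Pi.single j 1 : Fin D.n → ℤ) i := fun i => by
    rw [Pi.single_apply]; split_ifs <;> simp
  refine ⟨fun i => add_nonneg (hc.1 i) (hn i), ?_, ?_⟩
  · obtain ⟨i, hi, hi'⟩ := hc.2.1
    refine ⟨i, hi, ?_⟩
    have := hc.1 i
    have := hn i
    simp only [Pi.add_apply]
    omega
  · have := hc.2.2
    simp only [Pi.add_apply, Finset.sum_add_distrib]
    simp
    omega

theorem F_solve (D : SemisimpleWithBase L) (J : Finset (Fin D.n)) (s : D.cartan)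
    (hs : ∀ α ∈ D.posRoots,
      α ∉ Submodule.span ℤ (D.simple '' (J : Set (Fin D.n))) → α s ≠ 0)
    (k : ℕ) {u : L} (hu : u ∈ F D J k) : ∃ z ∈ F D J k, ⁅(s : L), z⁆ = u := by
  have : F D J k ≤ (F D J k).map (LieModule.toEnd ℂ L L (s : L)) := by
    refine S_le D fun c hc x hx => ?_
    by_cases hx0 : x = 0
    · subst hx0; exact zero_mem _
    have hne : eigSpace D.cartan (wt D c) ≠ ⊥ := fun h => hx0 (by simpa [h] using hx)
    obtain ⟨i, hi, hi'⟩ := hc.2.1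
    have hw0 : wt D c ≠ 0 := by
      rw [← wt_zero D]
      intro h
      exact hi' (congrFun (wt_inj D h) i)
    have hr := (eig_root D _ hne).resolve_left hw0
    have hsc : wt D c s ≠ 0 := by
      refine hs _ ⟨hr, fun i => (c i).toNat, ?_⟩ ?_
      · refine Finset.sum_congr rfl fun i _ => ?_
        congr 1
        have := Int.toNat_of_nonneg (hc.1 i)
        rw [← Int.cast_natCast, this]
      · intro hmem
        obtain ⟨h, hh⟩ := exists_elt D (Pi.single i 1)
        have h0 : ∀ α ∈ Submodule.span ℤ (D.simple '' (J : Set (Fin D.n))), α h = 0 := by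
          intro α hα
          induction hα using Submodule.span_induction with
          | mem x hx =>
            obtain ⟨j, hj, rfl⟩ := hx
            rw [hh, Pi.single_apply, if_neg]
            rintro rfl
            exact hi hj
          | zero => simp
          | add x y _ _ hx hy => simp [hx, hy]
          | smul a x _ hx => simp [hx]
        have := h0 _ hmem
        simp [wt, hh, Pi.single_apply] at this
        exact hi' this
    refine ⟨(wt D c s)⁻¹ • x, Submodule.smul_mem _ _ (mem_S D hc hx), ?_⟩
    rw [map_smul, LieModule.toEnd_apply_apply, hx s, smul_smul, inv_mul_cancel₀ hsc, one_smul]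
  obtain ⟨z, hz, h⟩ := this hu
  exact ⟨z, hz, h⟩

theorem ad_nil (D : SemisimpleWithBase L) (J : Finset (Fin D.n)) {k : ℕ} (hk : 1 ≤ k) {z : L}
    (hz : z ∈ F D J k) : IsNilpotent (LieModule.toEnd ℂ L L z) := by
  obtain ⟨K, hK⟩ := exists_bound D
  have step : ∀ m : ℕ, ∀ x : L, ((LieModule.toEnd ℂ L L z) ^ m) x ∈
      S D (fun c => (m : ℤ) - K ≤ ∑ i, c i) := by
    intro m
    induction m with
    | zero =>
      intro x
      have hle : S D (fun _ => True) ≤ S D (fun c => ((0 : ℕ) : ℤ) - K ≤ ∑ i, c i) := by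
        refine S_le D fun c _ => ?_
        by_cases hb : eigSpace D.cartan (wt D c) = ⊥
        · rw [hb]; exact bot_le
        · have := abs_lt.mp (hK c hb)
          refine fun y hy => mem_S D (c := c) ?_ hy
          simp only [Nat.cast_zero]
          omega
      apply hle
      rw [S_top]
      trivial
    | succ m ih =>
      intro x
      rw [pow_succ', Module.End.mul_apply, LieModule.toEnd_apply_apply]
      refine lie_S D (fun c d hc hd => ?_) hz (ih x)
      have := hc.2.2
      simp only [Pi.add_apply, Finset.sum_add_distrib]
      push_cast
      omega
  refine ⟨2 * K, ?_⟩
  ext x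
  have h := step (2 * K) x
  rw [S_bot D] at h
  · simpa using h
  · intro c hc
    by_contra hb
    have := abs_lt.mp (hK c hb)
    push_cast at hc
    omega

theorem exp_kill (D : SemisimpleWithBase L) (J : Finset (Fin D.n)) (s : D.cartan)
    (hs : ∀ α ∈ D.posRoots,
      α ∉ Submodule.span ℤ (D.simple '' (J : Set (Fin D.n))) → α s ≠ 0)
    (E : Fin D.n → L) (hE : ∀ i, E i ∈ eigSpace D.cartan (D.simple i))
    {t : ℂ} (ht : t ≠ 0) {k : ℕ} (hk : 1 ≤ k) {u : L} (hu : u ∈ F D J k) :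
    ∃ φ : L ≃ₗ⁅ℂ⁆ L, ∃ v ∈ F D J (k + 1),
      φ (t • ((s : L) + ∑ j ∈ J, E j) + u) = t • ((s : L) + ∑ j ∈ J, E j) + v := by
  obtain ⟨z, hz, hzu⟩ := F_solve D J s hs k (Submodule.smul_mem _ t⁻¹ hu)
  have hnil : IsNilpotent (LieDerivation.ad ℂ L z).toLinearMap := by
    rw [LieDerivation.coe_ad_apply_eq_ad_apply]
    exact ad_nil D J hk hz
  let _ : LieAlgebra ℚ L :=
    { Module.compHom L (algebraMap ℚ ℂ) with
      lie_smul := fun q x y => lie_smul (algebraMap ℚ ℂ q) x y }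
  have : IsScalarTower ℚ ℂ L := ⟨fun q c x => by
    change (q • c) • x = (algebraMap ℚ ℂ q) • c • x
    rw [Algebra.smul_def, mul_smul]⟩
  have hrest : (LieDerivation.ad ℂ L z).toLinearMap = LieModule.toEnd ℂ L L z :=
    LieDerivation.coe_ad_apply_eq_ad_apply ..
  set y := t • ((s : L) + ∑ j ∈ J, E j) with hy
  have hE' : ⁅z, ∑ j ∈ J, E j⁆ ∈ F D J (k + 1) := by
    rw [lie_sum]
    exact Submodule.sum_mem _ fun j _ => lie_F_E D J j hz (hE j)
  have hzu' : ⁅z, u⁆ ∈ F D J (k + 1) := F_anti D J (by omega) (lie_F D J hz hu)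
  have h1 : ⁅z, y + u⁆ + u ∈ F D J (k + 1) := by
    have : ⁅z, y + u⁆ + u = t • ⁅z, ∑ j ∈ J, E j⁆ + ⁅z, u⁆ := by
      rw [hy, lie_add, lie_smul, lie_add, ← lie_skew z (s : L), hzu, smul_add, smul_neg, smul_smul,
        mul_inv_cancel₀ ht, one_smul]
      abel
    rw [this]
    exact add_mem (Submodule.smul_mem _ _ hE') hzu'
  have h1' : ⁅z, y + u⁆ ∈ F D J k := by
    have := sub_mem (F_anti D J (Nat.le_succ k) h1) hu
    simpa using this
  have h2 : ∀ m : ℕ, ((LieModule.toEnd ℂ L L z) ^ (m + 2)) (y + u) ∈ F D J (k + 1) := by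
    intro m
    induction m with
    | zero =>
      rw [zero_add, pow_two, Module.End.mul_apply]
      exact F_anti D J (by omega) (lie_F D J hz h1')
    | succ m ih =>
      rw [show m + 1 + 2 = (m + 2) + 1 by ring, pow_succ', Module.End.mul_apply]
      exact F_anti D J (by omega) (lie_F D J hz ih)
  obtain ⟨N, hN⟩ := ad_nil D J hk hz
  have hN' : (LieModule.toEnd ℂ L L z) ^ (N + 2) = 0 := by rw [pow_add, hN, zero_mul]
  have hexp : IsNilpotent.exp (LieModule.toEnd ℂ L L z) (y + u) =
      (y + u) + ⁅z, y + u⁆ + ∑ i ∈ Finset.range N,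
        ((i + 2).factorial : ℚ)⁻¹ • ((LieModule.toEnd ℂ L L z) ^ (i + 2)) (y + u) := by
    rw [IsNilpotent.exp_eq_sum hN', Finset.sum_range_succ', Finset.sum_range_succ']
    simp [LinearMap.sum_apply]
    abel
  refine ⟨LieDerivation.exp (LieDerivation.ad ℂ L z) hnil,
    u + ⁅z, y + u⁆ + ∑ i ∈ Finset.range N,
      ((i + 2).factorial : ℚ)⁻¹ • ((LieModule.toEnd ℂ L L z) ^ (i + 2)) (y + u), ?_, ?_⟩
  · refine add_mem (by rwa [add_comm u]) (Submodule.sum_mem _ fun i _ => ?_)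
    exact Submodule.smul_of_tower_mem _ _ (h2 i)
  · rw [LieDerivation.exp_map_apply, hrest]
    refine Eq.trans hexp ?_
    abel

theorem unip (D : SemisimpleWithBase L) (J : Finset (Fin D.n)) (s : D.cartan)
    (hs : ∀ α ∈ D.posRoots,
      α ∉ Submodule.span ℤ (D.simple '' (J : Set (Fin D.n))) → α s ≠ 0)
    (E : Fin D.n → L) (hE : ∀ i, E i ∈ eigSpace D.cartan (D.simple i))
    {t : ℂ} (ht : t ≠ 0) {u : L} (hu : u ∈ F D J 1) :
    ∃ φ : L ≃ₗ⁅ℂ⁆ L,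
      φ (t • ((s : L) + ∑ j ∈ J, E j) + u) = t • ((s : L) + ∑ j ∈ J, E j) := by
  have key : ∀ m : ℕ, ∃ φ : L ≃ₗ⁅ℂ⁆ L, ∃ v ∈ F D J (m + 1),
      φ (t • ((s : L) + ∑ j ∈ J, E j) + u) = t • ((s : L) + ∑ j ∈ J, E j) + v := by
    intro m
    induction m with
    | zero => exact ⟨LieEquiv.refl, u, hu, rfl⟩
    | succ m ih =>
      obtain ⟨φ, v, hv, h⟩ := ih
      obtain ⟨ψ, w, hw, h'⟩ := exp_kill D J s hs E hE ht (by omega) hv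
      refine ⟨φ.trans ψ, w, hw, ?_⟩
      rw [LieEquiv.trans_apply, h, h']
  obtain ⟨K, hK⟩ := exists_bound D
  obtain ⟨φ, v, hv, h⟩ := key K
  have hb : F D J (K + 1) = ⊥ := by
    refine S_bot D fun c hc => ?_
    by_contra hb
    have := abs_lt.mp (hK c hb)
    have := hc.2.2
    push_cast at this
    omega
  rw [hb] at hv
  refine ⟨φ, ?_⟩
  rw [h, (Submodule.mem_bot ℂ).mp hv, add_zero]

theorem torus (D : SemisimpleWithBase L) (h : D.cartan) (a : ℂ) :
    ∃ φ : L ≃ₗ⁅ℂ⁆ L, ∀ α x, x ∈ eigSpace D.cartan α → φ x = Complex.exp (a * α h) • x := by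
  classical
  have hind : iSupIndep (fun c => eigSpace D.cartan (wt D c)) := (eig_indep D).comp (wt_inj D)
  have htop : (⨆ c, eigSpace D.cartan (wt D c)) = ⊤ := by
    rw [← S_top D]; simp [S]
  have hint : DirectSum.IsInternal (fun c => eigSpace D.cartan (wt D c)) :=
    (DirectSum.isInternal_submodule_iff_iSupIndep_and_iSup_eq_top _).mpr ⟨hind, htop⟩
  have hex : ∀ a : ℂ, ∃ f : L →ₗ[ℂ] L, ∀ c x, x ∈ eigSpace D.cartan (wt D c) →
      f x = Complex.exp (a * wt D c h) • x := by
    intro a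
    let e := LinearEquiv.ofBijective (DirectSum.coeLinearMap fun c => eigSpace D.cartan (wt D c)) hint
    refine ⟨(DirectSum.toModule ℂ _ L fun c =>
      Complex.exp (a * wt D c h) • (eigSpace D.cartan (wt D c)).subtype) ∘ₗ e.symm.toLinearMap,
      fun c x hx => ?_⟩
    have : e.symm x = DirectSum.lof ℂ _ (fun c => eigSpace D.cartan (wt D c)) c ⟨x, hx⟩ := by
      rw [LinearEquiv.symm_apply_eq]
      exact (DirectSum.coeLinearMap_lof (fun c => eigSpace D.cartan (wt D c)) c ⟨x, hx⟩).symm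
    simp [this]
  have ind : ∀ (p : L → Prop), (∀ c x, x ∈ eigSpace D.cartan (wt D c) → p x) →
      (∀ x y, p x → p y → p (x + y)) → p 0 → ∀ x, p x := by
    intro p h1 h2 h0 x
    have hx : x ∈ ⨆ c, eigSpace D.cartan (wt D c) := by rw [htop]; trivial
    exact Submodule.iSup_induction _ (motive := p) hx h1 h0 h2
  obtain ⟨f, hf⟩ := hex a
  obtain ⟨g, hg⟩ := hex (-a)
  have hfg : ∀ x, f (g x) = x := by
    refine ind _ (fun c x hx => ?_) (fun x y hx hy => by simp [hx, hy]) (by simp)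
    rw [hg c x hx, map_smul, hf c x hx, smul_smul, ← Complex.exp_add]
    simp
  have hgf : ∀ x, g (f x) = x := by
    refine ind _ (fun c x hx => ?_) (fun x y hx hy => by simp [hx, hy]) (by simp)
    rw [hf c x hx, map_smul, hg c x hx, smul_smul, ← Complex.exp_add]
    simp
  have hlie : ∀ x y, f ⁅x, y⁆ = ⁅f x, f y⁆ := by
    refine ind _ (fun c x hx => ?_) (fun x y hx hy => by simp [hx, hy]) (by simp)
    refine ind _ (fun d y hy => ?_) (fun x y hx hy => by simp [hx, hy]) (by simp)
    rw [hf c x hx, hf d y hy, hf (c + d) ⁅x, y⁆ (by rw [wt_add]; exact lie_eig D hx hy), smul_lie,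
      lie_smul, smul_smul, ← Complex.exp_add, wt_add]
    simp [mul_add]
  refine ⟨{ f with
    map_lie' := fun {x y} => hlie x y
    invFun := g
    left_inv := hgf
    right_inv := hfg }, fun α x hx => ?_⟩
  change f x = _
  by_cases hx0 : x = 0
  · simp [hx0]
  have hne : eigSpace D.cartan α ≠ ⊥ := fun h => hx0 (by simpa [h] using hx)
  obtain ⟨c, rfl⟩ : ∃ c, α = wt D c := by
    rcases eig_root D α hne with rfl | h
    · exact ⟨0, (wt_zero D).symm⟩
    · exact root_wt D h
  exact hf c x hx

end LineElt

/-- Let `J ⊆ {1, …, n}` and let `s ∈ 𝔥` be such that `α(s) ≠ 0` for every positive root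
`α` not lying in `Φ(J)`, the set of roots in the `ℤ`-span of the simple roots `αⱼ`,
`j ∈ J`.  Set `x_J = s + ∑_{j ∈ J} E j`, `N₀ = ∑ i, E i` and
`x t = t • x_J + (1 - t) • N₀`.  Then for every `t ≠ 0` there is a Lie algebra
automorphism `φ` of `𝔤` with `φ (x t) = t • x_J`. -/
theorem line_element_conjugate_to_regular
    {L : Type} [LieRing L] [LieAlgebra ℂ L] [Module.Finite ℂ L]
    [LieAlgebra.IsSemisimple ℂ L] (D : SemisimpleWithBase L)
    (E : Fin D.n → L) (hE : ∀ i, E i ∈ eigSpace D.cartan (D.simple i))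
    (hE0 : ∀ i, E i ≠ 0)
    (J : Finset (Fin D.n)) (s : D.cartan)
    (hs : ∀ α ∈ D.posRoots,
      α ∉ Submodule.span ℤ (D.simple '' (J : Set (Fin D.n))) → α s ≠ 0)
    (t : ℂ) (ht : t ≠ 0) :
    ∃ φ : L ≃ₗ[ℂ] L, (∀ x y : L, φ ⁅x, y⁆ = ⁅φ x, φ y⁆) ∧
      φ (t • ((s : L) + ∑ j ∈ J, E j) + (1 - t) • ∑ i, E i) =
        t • ((s : L) + ∑ j ∈ J, E j) := by
  obtain ⟨h, hh⟩ := LineElt.exists_elt D (fun _ => 1)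
  obtain ⟨φ, hφ⟩ := LineElt.torus D h (Complex.log t)
  have hφE : ∀ i, φ (E i) = t • E i := by
    intro i
    rw [hφ _ _ (hE i), hh, mul_one, Complex.exp_log ht]
  have hφs : φ (s : L) = s := by
    rw [hφ 0 _ (LineElt.cartan_le D s.2)]
    simp
  have hu : (t * (1 - t)) • ∑ i ∈ Jᶜ, E i ∈ LineElt.F D J 1 := by
    refine Submodule.smul_mem _ _ (Submodule.sum_mem _ fun i hi => ?_)
    refine LineElt.mem_S D (c := Pi.single i 1) (?_ : _ ∧ _ ∧ _) ?_
    · refine ⟨fun j => ?_, ⟨i, by simpa using hi, by simp⟩, by simp⟩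
      rw [Pi.single_apply]; split_ifs <;> simp
    · rw [LineElt.wt_single]
      exact hE i
  obtain ⟨ψ, hψ⟩ := LineElt.unip D J s hs E hE ht hu
  refine ⟨(φ.trans ψ).toLinearEquiv, fun x y => (φ.trans ψ).map_lie x y, ?_⟩
  change ψ (φ _) = _
  refine Eq.trans (congrArg ψ ?_) hψ
  rw [← Finset.sum_add_sum_compl J E]
  simp only [map_add, map_smul, map_sum, hφE, hφs, ← Finset.smul_sum]
  module
end
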